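/- arXiv:1604.00995 — 2 statements merged into one kernel-verified Lean document; each statement's English description precedes it below -/
import Mathlib

section
/- Let Φ be a norm on ℝ^{n+1} cylindrical over a norm φ on ℝ^n, Ω̂ ⊆ ℝ^n an open set, u ∈ M_{Φ^o}(Ω̂), and f : ℝ → ℝ a monotone function. Then f ∘ u ∈ BV_loc(Ω̂) and f ∘ u ∈ M_{Φ^o}(Ω̂). -/
open MeasureTheory Set Filter

noncomputable section

/-- `ℝ^n` with the Euclidean norm. -/
abbrev Rn (n : ℕ) := EuclideanSpace ℝ (Fin n)

/-- `ℝ^{n+1} = ℝ^n × ℝ`. -/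
abbrev Rn1 (n : ℕ) := Rn n × ℝ

/-- Euclidean dot product on `ℝ^n`. -/
def dotn {n : ℕ} (x y : Rn n) : ℝ := ∑ i, x i * y i

/-- Euclidean dot product on `ℝ^{n+1} = ℝ^n × ℝ`. -/
def dotp {n : ℕ} (x y : Rn1 n) : ℝ := dotn x.1 y.1 + x.2 * y.2

/-- Euclidean norm on `ℝ^{n+1} = ℝ^n × ℝ`. -/
def enorm1 {n : ℕ} (x : Rn1 n) : ℝ := Real.sqrt (dotp x x)

/-- `Ψ` is a norm on `ℝ^n`: convex, absolutely one-homogeneous and bounded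
below by a positive multiple of the Euclidean norm. -/
def IsNormN {n : ℕ} (Ψ : Rn n → ℝ) : Prop :=
  ConvexOn ℝ univ Ψ ∧ (∀ (c : ℝ) (ξ : Rn n), Ψ (c • ξ) = |c| * Ψ ξ) ∧
    ∃ c > (0:ℝ), ∀ ξ, c * ‖ξ‖ ≤ Ψ ξ

/-- `Φ` is a norm on `ℝ^{n+1}`. -/
def IsNorm1 {n : ℕ} (Φ : Rn1 n → ℝ) : Prop :=
  ConvexOn ℝ univ Φ ∧ (∀ (c : ℝ) (ξ : Rn1 n), Φ (c • ξ) = |c| * Φ ξ) ∧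
    ∃ c > (0:ℝ), ∀ ξ, c * enorm1 ξ ≤ Φ ξ

/-- Dual norm on `ℝ^n`: `Ψ^o(ξ*) = sup {ξ*·ξ : Ψ(ξ) ≤ 1}`. -/
def dualN {n : ℕ} (Ψ : Rn n → ℝ) (xs : Rn n) : ℝ :=
  sSup ((fun ξ => dotn xs ξ) '' {ξ | Ψ ξ ≤ 1})

/-- Dual norm on `ℝ^{n+1}`. -/
def dual1 {n : ℕ} (Φ : Rn1 n → ℝ) (xs : Rn1 n) : ℝ :=
  sSup ((fun ξ => dotp xs ξ) '' {ξ | Φ ξ ≤ 1})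

/-- `Φ` is cylindrical over `φ`: `Φ(ξ̂,ξ_{n+1}) = max (φ(ξ̂), |ξ_{n+1}|)`. -/
def Cylindrical {n : ℕ} (Φ : Rn1 n → ℝ) (φ : Rn n → ℝ) : Prop :=
  ∀ ξ : Rn1 n, Φ ξ = max (φ ξ.1) |ξ.2|

/-- `A` is an open set compactly contained in `O`. -/
def CpCtd {E : Type*} [TopologicalSpace E] (A O : Set E) : Prop :=
  IsOpen A ∧ IsCompact (closure A) ∧ closure A ⊆ O

/-- Divergence of a vector field on `ℝ^n`. -/
def divN {n : ℕ} (η : Rn n → Rn n) (x : Rn n) : ℝ :=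
  ∑ i, fderiv ℝ η x (EuclideanSpace.single i (1:ℝ)) i

/-- Divergence of a vector field on `ℝ^{n+1} = ℝ^n × ℝ`. -/
def div1 {n : ℕ} (η : Rn1 n → Rn1 n) (z : Rn1 n) : ℝ :=
  (∑ i, (fderiv ℝ η z (EuclideanSpace.single i (1:ℝ), (0:ℝ))).1 i) +
    (fderiv ℝ η z ((0 : Rn n), (1:ℝ))).2

/-- Admissible test vector fields on `ℝ^n`: `C^1`, compactly supported in `A`,
with values in the unit ball of `Ψ`. -/
def TestN {n : ℕ} (A : Set (Rn n)) (Ψ : Rn n → ℝ) (η : Rn n → Rn n) : Prop :=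
  ContDiff ℝ 1 η ∧ HasCompactSupport η ∧ tsupport η ⊆ A ∧ ∀ x, Ψ (η x) ≤ 1

/-- Admissible test vector fields on `ℝ^{n+1}`. -/
def Test1 {n : ℕ} (A : Set (Rn1 n)) (Φ : Rn1 n → ℝ) (η : Rn1 n → Rn1 n) : Prop :=
  ContDiff ℝ 1 η ∧ HasCompactSupport η ∧ tsupport η ⊆ A ∧ ∀ z, Φ (η z) ≤ 1

/-- The set of numbers whose supremum is the anisotropic perimeter `P_Ψ(E,A)` in `ℝ^n`. -/
def perSetN {n : ℕ} (Ψ : Rn n → ℝ) (E A : Set (Rn n)) : Set ℝ :=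
  {r | ∃ η, TestN A Ψ η ∧ r = -∫ x in E, divN η x}

/-- Anisotropic perimeter `P_Ψ(E,A)` in `ℝ^n`. -/
def PerN {n : ℕ} (Ψ : Rn n → ℝ) (E A : Set (Rn n)) : ℝ := sSup (perSetN Ψ E A)

/-- `E` has locally finite perimeter in `O ⊆ ℝ^n`. -/
def BVlocSetN {n : ℕ} (O E : Set (Rn n)) : Prop :=
  ∀ A, CpCtd A O → BddAbove (perSetN (fun x => ‖x‖) E A)

/-- `E` is a minimizer of `P_Ψ` (by compact perturbations) in `O ⊆ ℝ^n`. -/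
def MinPerN {n : ℕ} (Ψ : Rn n → ℝ) (O E : Set (Rn n)) : Prop :=
  BVlocSetN O E ∧ ∀ A, CpCtd A O → ∀ F, BVlocSetN O F →
    IsCompact (closure (symmDiff E F)) → closure (symmDiff E F) ⊆ A →
      PerN Ψ E A ≤ PerN Ψ F A

/-- The set of numbers whose supremum is the anisotropic perimeter `P_Φ(E,A)` in `ℝ^{n+1}`. -/
def perSet1 {n : ℕ} (Φ : Rn1 n → ℝ) (E A : Set (Rn1 n)) : Set ℝ :=
  {r | ∃ η, Test1 A Φ η ∧ r = -∫ z in E, div1 η z}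

/-- Anisotropic perimeter `P_Φ(E,A)` in `ℝ^{n+1}`. -/
def Per1 {n : ℕ} (Φ : Rn1 n → ℝ) (E A : Set (Rn1 n)) : ℝ := sSup (perSet1 Φ E A)

/-- `E` has locally finite perimeter in `O ⊆ ℝ^{n+1}`. -/
def BVlocSet1 {n : ℕ} (O E : Set (Rn1 n)) : Prop :=
  ∀ A, CpCtd A O → BddAbove (perSet1 enorm1 E A)

/-- `E` is a minimizer of `P_Φ` (by compact perturbations) in `O ⊆ ℝ^{n+1}`. -/
def MinPer1 {n : ℕ} (Φ : Rn1 n → ℝ) (O E : Set (Rn1 n)) : Prop :=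
  BVlocSet1 O E ∧ ∀ A, CpCtd A O → ∀ F, BVlocSet1 O F →
    IsCompact (closure (symmDiff E F)) → closure (symmDiff E F) ⊆ A →
      Per1 Φ E A ≤ Per1 Φ F A

/-- The set of numbers whose supremum is the total variation `TV(u,A)`. -/
def varSet {n : ℕ} (A : Set (Rn n)) (u : Rn n → ℝ) : Set ℝ :=
  {r | ∃ η, TestN A (fun x => ‖x‖) η ∧ r = ∫ x in A, u x * divN η x}

/-- Total variation `TV(u,A)`. -/
def TV {n : ℕ} (u : Rn n → ℝ) (A : Set (Rn n)) : ℝ := sSup (varSet A u)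

/-- `u ∈ BV_loc(Ω̂)`. -/
def BVlocFun {n : ℕ} (Ω : Set (Rn n)) (u : Rn n → ℝ) : Prop :=
  (∀ A, CpCtd A Ω → IntegrableOn u A) ∧ ∀ A, CpCtd A Ω → BddAbove (varSet A u)

/-- The set of numbers whose supremum is `G_{Φ^o}(u,A)`. -/
def Gset {n : ℕ} (Φ : Rn1 n → ℝ) (A : Set (Rn n)) (u : Rn n → ℝ) : Set ℝ :=
  {r | ∃ η : Rn n → Rn1 n, ContDiff ℝ 1 η ∧ HasCompactSupport η ∧ tsupport η ⊆ A ∧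
    (∀ x, Φ (η x) ≤ 1) ∧ r = ∫ x in A, (u x * divN (fun y => (η y).1) x + (η x).2)}

/-- The functional `G_{Φ^o}(u,A)`. -/
def Gfun {n : ℕ} (Φ : Rn1 n → ℝ) (u : Rn n → ℝ) (A : Set (Rn n)) : ℝ := sSup (Gset Φ A u)

/-- `w` has compact support contained in `A`. -/
def CptSupp {n : ℕ} (A : Set (Rn n)) (w : Rn n → ℝ) : Prop :=
  IsCompact (tsupport w) ∧ tsupport w ⊆ A

/-- `u` is a minimizer of `G_{Φ^o}` by compact perturbations in `Ω̂`,
i.e. `u ∈ M_{Φ^o}(Ω̂)`. -/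
def MinG {n : ℕ} (Φ : Rn1 n → ℝ) (Ω : Set (Rn n)) (u : Rn n → ℝ) : Prop :=
  BVlocFun Ω u ∧ ∀ A, CpCtd A Ω → ∀ v, BVlocFun Ω v →
    CptSupp A (fun x => u x - v x) → Gfun Φ u A ≤ Gfun Φ v A

/-- `u` is a minimizer of the total variation by compact perturbations in `Ω̂`. -/
def MinTV {n : ℕ} (Ω : Set (Rn n)) (u : Rn n → ℝ) : Prop :=
  BVlocFun Ω u ∧ ∀ A, CpCtd A Ω → ∀ v, BVlocFun Ω v →
    CptSupp A (fun x => u x - v x) → TV u A ≤ TV v A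

/-- Subgraph of `u : Ω̂ → ℝ`. -/
def sg {n : ℕ} (Ω : Set (Rn n)) (u : Rn n → ℝ) : Set (Rn1 n) :=
  {p | p.1 ∈ Ω ∧ p.2 < u p.1}

/-- `S` is locally a Lipschitz graph at `p`. -/
def IsLocLipGraphAt {n : ℕ} (S : Set (Rn1 n)) (p : Rn1 n) : Prop :=
  ∃ U : Set (Rn1 n), IsOpen U ∧ p ∈ U ∧ ∃ e : Rn1 n, enorm1 e = 1 ∧
    ∃ g : Rn1 n → ℝ, (∃ L : NNReal, LipschitzOnWith L g {y | dotp y e = 0}) ∧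
      S ∩ U = {z | ∃ y, dotp y e = 0 ∧ z = y + g y • e} ∩ U

/-- `Φ` is a partially monotone norm on `ℝ^{n+1}`. -/
def PartMono {n : ℕ} (Φ : Rn1 n → ℝ) : Prop :=
  ∀ ξ η : Rn1 n, Φ (ξ.1, 0) ≤ Φ (η.1, 0) → Φ ((0 : Rn n), ξ.2) ≤ Φ ((0 : Rn n), η.2) →
    Φ ξ ≤ Φ η

end


open MeasureTheory Set Filter

def Fld {n : ℕ} (η : Rn n → Rn n) : Prop := ContDiff ℝ 1 η ∧ HasCompactSupport η

noncomputable def JJ {n : ℕ} (v : Rn n → ℝ) (η : Rn n → Rn n) : ℝ := ∫ x, v x * divN η x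

def UB {n : ℕ} (φ : Rn n → ℝ) (A : Set (Rn n)) (v : Rn n → ℝ) (B : ℝ) : Prop :=
  ∀ η, TestN A φ η → JJ v η ≤ B

def LI {n : ℕ} (Ω : Set (Rn n)) (g : Rn n → ℝ) : Prop := ∀ A, CpCtd A Ω → IntegrableOn g A

section basics
variable {n : ℕ}

lemma TestN.fld {A : Set (Rn n)} {φ : Rn n → ℝ} {η : Rn n → Rn n} (h : TestN A φ η) : Fld η :=
  ⟨h.1, h.2.1⟩

lemma Fld.diff {η : Rn n → Rn n} (h : Fld η) : Differentiable ℝ η :=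
  h.1.differentiable (by norm_num)

lemma divN_zero (x : Rn n) : divN (fun _ => (0 : Rn n)) x = 0 := by simp [divN]

lemma divN_add {η ζ : Rn n → Rn n} (h : Differentiable ℝ η) (h' : Differentiable ℝ ζ) (x : Rn n) :
    divN (fun y => η y + ζ y) x = divN η x + divN ζ x := by
  unfold divN
  rw [fderiv_fun_add (h x) (h' x), ← Finset.sum_add_distrib]
  simp

lemma divN_smul {a : Rn n → ℝ} {η : Rn n → Rn n} (h : Differentiable ℝ a)
    (h' : Differentiable ℝ η) (x : Rn n) :
    divN (fun y => a y • η y) x = a x * divN η x + fderiv ℝ a x (η x) := by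
  unfold divN
  rw [fderiv_fun_smul (h x) (h' x)]
  have e : fderiv ℝ a x (η x) =
      ∑ i, fderiv ℝ a x (EuclideanSpace.single i (1:ℝ)) * η x i := by
    have : η x = ∑ i, η x i • EuclideanSpace.single i (1:ℝ) := by
      ext j
      simp [Finset.sum_apply, Pi.single_apply]
    conv_lhs => rw [this]
    rw [map_sum]
    refine Finset.sum_congr rfl fun i _ => ?_
    rw [map_smul]; simp [mul_comm]
  rw [e, Finset.mul_sum, ← Finset.sum_add_distrib]
  simp

lemma divN_const_smul (c : ℝ) {η : Rn n → Rn n} (h' : Differentiable ℝ η) (x : Rn n) :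
    divN (fun y => c • η y) x = c * divN η x := by
  have := divN_smul (a := fun _ => c) (differentiable_const c) h' x
  simpa using this

lemma divN_continuous {η : Rn n → Rn n} (h : ContDiff ℝ 1 η) : Continuous (divN η) := by
  unfold divN
  have := h.continuous_fderiv (by norm_num)
  refine continuous_finsetSum _ fun i _ => ?_
  have h2 : Continuous fun x => fderiv ℝ η x (EuclideanSpace.single i (1:ℝ)) :=
    this.clm_apply continuous_const
  exact (EuclideanSpace.proj i : Rn n →L[ℝ] ℝ).continuous.comp h2

lemma divN_eq_zero {η : Rn n → Rn n} {x : Rn n} (hx : x ∉ tsupport η) : divN η x = 0 := by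
  unfold divN
  have : fderiv ℝ η x = 0 := by
    by_contra h
    exact hx (support_fderiv_subset ℝ (by simpa using h))
  simp [this]

lemma tsupport_divN {η : Rn n → Rn n} : tsupport (divN η) ⊆ tsupport η := by
  refine closure_minimal (fun x hx => ?_) (isClosed_tsupport _)
  by_contra h
  exact hx (divN_eq_zero h)

lemma Fld.divN_compact {η : Rn n → Rn n} (h : Fld η) : HasCompactSupport (divN η) :=
  h.2.isCompact.of_isClosed_subset (isClosed_tsupport _) tsupport_divN

lemma exists_cp {K Ω : Set (Rn n)} (hK : IsCompact K) (hΩ : IsOpen Ω) (h : K ⊆ Ω) :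
    ∃ A, CpCtd A Ω ∧ K ⊆ A := by
  obtain ⟨V, h1, h2, h3, h4⟩ := exists_open_between_and_isCompact_closure hK hΩ h
  exact ⟨V, ⟨h1, h4, h3⟩, h2⟩

lemma integrable_mul_of_on {A : Set (Rn n)} {g b : Rn n → ℝ} (hA : MeasurableSet A)
    (hg : IntegrableOn g A) (hb : Continuous b) (hc : HasCompactSupport b)
    (hs : tsupport b ⊆ A) : Integrable (fun x => g x * b x) := by
  obtain ⟨C, hC⟩ := hc.exists_bound_of_continuous hb
  have h1 : IntegrableOn (fun x => g x * b x) A :=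
    Integrable.mul_bdd (c := C) hg hb.aestronglyMeasurable (ae_of_all _ hC)
  rw [← integrable_indicator_iff hA] at h1
  refine h1.congr (ae_of_all _ fun x => ?_)
  by_cases hx : x ∈ A
  · simp [hx]
  · have : b x = 0 := image_eq_zero_of_notMem_tsupport fun h => hx (hs h)
    simp [hx, this]

lemma LI.integrable_mul {Ω : Set (Rn n)} {g b : Rn n → ℝ} (hΩ : IsOpen Ω) (hg : LI Ω g)
    (hb : Continuous b) (hc : HasCompactSupport b) (hs : tsupport b ⊆ Ω) :
    Integrable (fun x => g x * b x) := by
  obtain ⟨A, hA, hKA⟩ := exists_cp hc.isCompact hΩ hs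
  exact integrable_mul_of_on hA.1.measurableSet (hg A hA) hb hc hKA

lemma LI.integrable_div {Ω : Set (Rn n)} {g : Rn n → ℝ} {η : Rn n → Rn n} (hΩ : IsOpen Ω)
    (hg : LI Ω g) (h : Fld η) (hs : tsupport η ⊆ Ω) : Integrable (fun x => g x * divN η x) :=
  hg.integrable_mul hΩ (divN_continuous h.1) h.divN_compact (tsupport_divN.trans hs)

lemma LI.add {Ω : Set (Rn n)} {g h : Rn n → ℝ} (hg : LI Ω g) (hh : LI Ω h) :
    LI Ω (fun x => g x + h x) := fun A hA => (hg A hA).add (hh A hA)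

lemma LI.sub {Ω : Set (Rn n)} {g h : Rn n → ℝ} (hg : LI Ω g) (hh : LI Ω h) :
    LI Ω (fun x => g x - h x) := fun A hA => (hg A hA).sub (hh A hA)

lemma LI.const_mul {Ω : Set (Rn n)} {g : Rn n → ℝ} (hg : LI Ω g) (c : ℝ) :
    LI Ω (fun x => c * g x) := fun A hA => (hg A hA).const_mul c

lemma CpCtd.finite {A Ω : Set (Rn n)} (h : CpCtd A Ω) : volume A < ⊤ :=
  (measure_mono subset_closure).trans_lt h.2.1.measure_lt_top

lemma LI.mul_bdd {Ω : Set (Rn n)} {g b : Rn n → ℝ} (hg : LI Ω g) (hb : Continuous b) (C : ℝ)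
    (hC : ∀ x, |b x| ≤ C) : LI Ω (fun x => b x * g x) := fun A hA =>
  Integrable.bdd_mul (c := C) (hg A hA) hb.aestronglyMeasurable (ae_of_all _ hC)

lemma JJ_set {A : Set (Rn n)} {v : Rn n → ℝ} {η : Rn n → Rn n} (h : tsupport η ⊆ A) :
    ∫ x in A, v x * divN η x = JJ v η := by
  refine setIntegral_eq_integral_of_forall_compl_eq_zero fun x hx => ?_
  rw [divN_eq_zero fun h' => hx (h h'), mul_zero]

lemma integral_divN {η : Rn n → Rn n} (h : Fld η) : ∫ x, divN η x = 0 := by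
  unfold divN
  have hc := h.1.continuous_fderiv (by norm_num)
  have hcs : HasCompactSupport (fderiv ℝ η) := h.2.fderiv ℝ
  have key : ∀ i : Fin n,
      (fun x => fderiv ℝ η x (EuclideanSpace.single i (1:ℝ)) i) =
      fun x => fderiv ℝ (fun y => η y i) x (EuclideanSpace.single i (1:ℝ)) := by
    intro i; funext x
    have := ((EuclideanSpace.proj i : Rn n →L[ℝ] ℝ).hasFDerivAt.comp x (h.diff x).hasFDerivAt)
    have h2 := this.fderiv
    have h3 : (⇑(EuclideanSpace.proj i : Rn n →L[ℝ] ℝ) ∘ η) = fun y => η y i := rfl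
    rw [h3] at h2
    rw [h2]; rfl
  have hint : ∀ i : Fin n,
      Integrable (fun x => fderiv ℝ η x (EuclideanSpace.single i (1:ℝ)) i) := by
    intro i
    refine Continuous.integrable_of_hasCompactSupport ?_ ?_
    · exact (EuclideanSpace.proj i : Rn n →L[ℝ] ℝ).continuous.comp (hc.clm_apply continuous_const)
    · exact hcs.comp_left
        (g := fun T : Rn n →L[ℝ] Rn n => T (EuclideanSpace.single i (1:ℝ)) i) (by simp)
  rw [integral_finsetSum _ fun i _ => hint i]
  refine Finset.sum_eq_zero fun i _ => ?_
  have hi := hint i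
  rw [key] at hi ⊢
  have d : Differentiable ℝ fun y => η y i :=
    (EuclideanSpace.proj i : Rn n →L[ℝ] ℝ).differentiable.comp h.diff
  have e := integral_mul_fderiv_eq_neg_fderiv_mul_of_integrable (𝕜 := ℝ) (μ := (volume : Measure (Rn n)))
    (f := fun _ => (1:ℝ)) (g := fun y => η y i) (v := EuclideanSpace.single i (1:ℝ))
    (by simp) (by simpa using hi) (by
      simp only [one_mul]
      refine Continuous.integrable_of_hasCompactSupport d.continuous ?_
      exact h.2.comp_left (g := fun T : Rn n => T i) (by simp))
    (by simp) (fun x _ => d x)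
  simpa using e

end basics

open MeasureTheory Set Filter

section norms
variable {n : ℕ} {φ : Rn n → ℝ}

lemma IsNormN.zero (h : IsNormN φ) : φ 0 = 0 := by
  have := h.2.1 0 0
  simpa using this

lemma IsNormN.neg (h : IsNormN φ) (x : Rn n) : φ (-x) = φ x := by
  have := h.2.1 (-1) x
  simpa using this

lemma IsNormN.smul (h : IsNormN φ) {c : ℝ} (hc : 0 ≤ c) (x : Rn n) : φ (c • x) = c * φ x := by
  rw [h.2.1, abs_of_nonneg hc]

lemma IsNormN.add (h : IsNormN φ) (x y : Rn n) : φ (x + y) ≤ φ x + φ y := by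
  have hc : ConvexOn ℝ univ φ := h.1
  have h1 := hc.2 (mem_univ x) (mem_univ y) (show (0:ℝ) ≤ 1/2 by norm_num)
    (show (0:ℝ) ≤ 1/2 by norm_num) (by norm_num)
  rw [← smul_add, h.smul (by norm_num)] at h1
  simp only [smul_eq_mul] at h1
  linarith

lemma IsNormN.nonneg (h : IsNormN φ) (x : Rn n) : 0 ≤ φ x := by
  obtain ⟨c, hc, h'⟩ := h.2.2
  exact le_trans (by positivity) (h' x)

lemma IsNormN.lower (h : IsNormN φ) : ∃ C > 0, ∀ x, ‖x‖ ≤ C * φ x := by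
  obtain ⟨c, hc, h'⟩ := h.2.2
  refine ⟨c⁻¹, by positivity, fun x => ?_⟩
  rw [inv_mul_eq_div, le_div_iff₀ hc, mul_comm]; exact h' x

lemma IsNormN.sum (h : IsNormN φ) {ι : Type*} (s : Finset ι) (f : ι → Rn n) :
    φ (∑ i ∈ s, f i) ≤ ∑ i ∈ s, φ (f i) := by
  classical
  induction s using Finset.induction_on with
  | empty => simp [h.zero]
  | insert a s ha ih =>
    rw [Finset.sum_insert ha, Finset.sum_insert ha]
    exact (h.add _ _).trans (by linarith)

lemma IsNormN.upper (h : IsNormN φ) : ∃ C > 0, ∀ x, φ x ≤ C * ‖x‖ := by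
  have hs : 0 ≤ ∑ i, φ (EuclideanSpace.single i (1:ℝ)) :=
    Finset.sum_nonneg fun i _ => h.nonneg _
  refine ⟨∑ i, φ (EuclideanSpace.single i (1:ℝ)) + 1, by linarith, fun x => ?_⟩
  have hx : x = ∑ i, x i • EuclideanSpace.single i (1:ℝ) := by
    ext j
    simp [Finset.sum_apply, Pi.single_apply]
  have h1 : φ x ≤ ∑ i, φ (x i • EuclideanSpace.single i (1:ℝ)) := by
    conv_lhs => rw [hx]
    exact h.sum _ _
  have h2 : ∑ i, φ (x i • EuclideanSpace.single i (1:ℝ)) ≤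
      ∑ i, φ (EuclideanSpace.single i (1:ℝ)) * ‖x‖ := by
    refine Finset.sum_le_sum fun i _ => ?_
    rw [h.2.1, mul_comm]
    exact mul_le_mul_of_nonneg_left (PiLp.norm_apply_le x i) (h.nonneg _)
  rw [← Finset.sum_mul] at h2
  have := norm_nonneg x
  nlinarith

lemma isNormN_norm : IsNormN (fun x : Rn n => ‖x‖) :=
  ⟨convexOn_norm convex_univ, fun c x => by simp [norm_smul], 1, one_pos, fun x => by simp⟩

lemma Fld.smul {a : Rn n → ℝ} {η : Rn n → Rn n} (ha : ContDiff ℝ 1 a) (h : Fld η) :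
    Fld (fun x => a x • η x) := ⟨ContDiff.smul ha h.1, HasCompactSupport.smul_left (f := a) h.2⟩

lemma Fld.add {η ζ : Rn n → Rn n} (h : Fld η) (h' : Fld ζ) :
    Fld (fun x => η x + ζ x) := ⟨h.1.add h'.1, h.2.add h'.2⟩

lemma Fld.const_smul {η : Rn n → Rn n} (c : ℝ) (h : Fld η) :
    Fld (fun x => c • η x) := h.smul (a := fun _ => c) contDiff_const

lemma fld_zero : Fld (fun _ : Rn n => (0 : Rn n)) := ⟨contDiff_const, HasCompactSupport.zero⟩

lemma tsupport_smul_sub {a : Rn n → ℝ} {η : Rn n → Rn n} :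
    tsupport (fun x => a x • η x) ⊆ tsupport η := tsupport_smul_subset_right a η

lemma tsupport_add_sub {A : Set (Rn n)} {η ζ : Rn n → Rn n} (h : tsupport η ⊆ A)
    (h' : tsupport ζ ⊆ A) :
    tsupport (fun x => η x + ζ x) ⊆ A := (tsupport_add η ζ).trans (union_subset h h')

lemma tsupport_sub_of {ψ : Rn n → ℝ} (hφ : IsNormN φ) {η : Rn n → Rn n}
    (h : ∀ x, φ (η x) ≤ ψ x) : tsupport η ⊆ tsupport ψ := by
  refine closure_mono fun x hx => ?_
  simp only [Function.mem_support] at hx ⊢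
  intro h0
  obtain ⟨C, hC, hl⟩ := hφ.lower
  have h1 := h x
  rw [h0] at h1
  have h2 := hl (η x)
  exact hx (norm_le_zero_iff.1 (h2.trans (by nlinarith)))

lemma JJ_const_smul (v : Rn n → ℝ) (c : ℝ) {η : Rn n → Rn n} (h : Fld η) :
    JJ v (fun x => c • η x) = c * JJ v η := by
  unfold JJ
  rw [← integral_const_mul]
  congr 1; funext x; rw [divN_const_smul c h.diff]; ring

lemma JJ_add_field {Ω : Set (Rn n)} (hΩ : IsOpen Ω) {v : Rn n → ℝ} (hv : LI Ω v)
    {η ζ : Rn n → Rn n} (h : Fld η) (h' : Fld ζ) (hs : tsupport η ⊆ Ω) (hs' : tsupport ζ ⊆ Ω) :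
    JJ v (fun x => η x + ζ x) = JJ v η + JJ v ζ := by
  unfold JJ
  rw [← integral_add (hv.integrable_div hΩ h hs) (hv.integrable_div hΩ h' hs')]
  congr 1; funext x; rw [divN_add h.diff h'.diff]; ring

lemma JJ_add_fun {Ω : Set (Rn n)} (hΩ : IsOpen Ω) {v w : Rn n → ℝ} (hv : LI Ω v) (hw : LI Ω w)
    {η : Rn n → Rn n} (h : Fld η) (hs : tsupport η ⊆ Ω) :
    JJ (fun x => v x + w x) η = JJ v η + JJ w η := by
  unfold JJ
  rw [← integral_add (hv.integrable_div hΩ h hs) (hw.integrable_div hΩ h hs)]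
  congr 1; funext x; ring

lemma JJ_const_mul (c : ℝ) (v : Rn n → ℝ) (η : Rn n → Rn n) :
    JJ (fun x => c * v x) η = c * JJ v η := by
  unfold JJ
  rw [← integral_const_mul]
  congr 1; funext x; ring

/-- basic cut-off formula -/
lemma JJ_cut {Ω : Set (Rn n)} (hΩ : IsOpen Ω) {v g ψ : Rn n → ℝ} (hv : LI Ω v) (hg : LI Ω g)
    (hψ : ContDiff ℝ 1 ψ)
    {η : Rn n → Rn n} (h : Fld η) (hs : tsupport η ⊆ Ω) :
    JJ (fun x => ψ x * v x + (1 - ψ x) * g x) η =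
      JJ v (fun x => ψ x • η x) + JJ g (fun x => (1 - ψ x) • η x) +
        ∫ x, (g x - v x) * fderiv ℝ ψ x (η x) := by
  have hψ' : ContDiff ℝ 1 (fun x => 1 - ψ x) := contDiff_const.sub hψ
  have hd := hψ.differentiable (by norm_num)
  have hd' := hψ'.differentiable (by norm_num)
  have i1 := hv.integrable_div hΩ (h.smul hψ) (tsupport_smul_sub.trans hs)
  have i2 := hg.integrable_div hΩ (h.smul hψ') (tsupport_smul_sub.trans hs)
  have i3 : Integrable fun x => (g x - v x) * fderiv ℝ ψ x (η x) := by
    have hsub : tsupport (fun x => fderiv ℝ ψ x (η x)) ⊆ tsupport η := by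
      refine closure_mono fun x hx => ?_
      simp only [Function.mem_support] at hx ⊢
      intro h0; exact hx (by simp [h0])
    refine (hg.sub hv).integrable_mul hΩ ((hψ.continuous_fderiv (by norm_num)).clm_apply
      h.1.continuous) ?_ (hsub.trans hs)
    exact h.2.isCompact.of_isClosed_subset (isClosed_tsupport _) hsub
  unfold JJ
  have i12 : Integrable fun x => v x * divN (fun x => ψ x • η x) x +
    g x * divN (fun x => (1 - ψ x) • η x) x := i1.add i2
  rw [← integral_add i1 i2, ← integral_add i12 i3]
  congr 1; funext x
  rw [divN_smul hd h.diff, divN_smul hd' h.diff]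
  have : fderiv ℝ (fun x => 1 - ψ x) x = - fderiv ℝ ψ x := by
    rw [fderiv_const_sub]
  rw [this]
  simp only [ContinuousLinearMap.neg_apply]
  ring

lemma testN_scale {φ' : Rn n → ℝ} (hφ' : IsNormN φ') {A : Set (Rn n)}
    {C : ℝ} (hC : 0 < C) (h : ∀ x, φ' x ≤ C * φ x) {η : Rn n → Rn n} (hη : TestN A φ η) :
    TestN A φ' (fun x => C⁻¹ • η x) := by
  refine ⟨(hη.fld.const_smul _).1, (hη.fld.const_smul _).2, ?_, fun x => ?_⟩
  · exact (tsupport_smul_sub (a := fun _ => C⁻¹)).trans hη.2.2.1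
  · rw [hφ'.smul (by positivity), inv_mul_le_iff₀ hC]
    exact (h _).trans (mul_le_mul_of_nonneg_left (hη.2.2.2 x) hC.le)

lemma UB.change {φ' : Rn n → ℝ} (hφ' : IsNormN φ') {A : Set (Rn n)}
    {C : ℝ} (hC : 0 < C) (h : ∀ x, φ' x ≤ C * φ x) {v : Rn n → ℝ} {B : ℝ} (hB : UB φ' A v B) :
    UB φ A v (C * B) := by
  intro η hη
  have := hB _ (testN_scale hφ' hC h hη)
  rw [JJ_const_smul _ _ hη.fld, inv_mul_le_iff₀ hC] at this
  exact this

lemma bvloc_iff (hφ : IsNormN φ) {Ω : Set (Rn n)} {v : Rn n → ℝ} :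
    BVlocFun Ω v ↔ LI Ω v ∧ ∀ A, CpCtd A Ω → ∃ B, UB φ A v B := by
  refine and_congr_right fun _ => forall₂_congr fun A hA => ?_
  have e : BddAbove (varSet A v) ↔ ∃ B, UB (fun x => ‖x‖) A v B := by
    constructor
    · rintro ⟨B, hB⟩
      refine ⟨B, fun η hη => hB ⟨η, hη, ?_⟩⟩
      rw [JJ_set hη.2.2.1]
    · rintro ⟨B, hB⟩
      refine ⟨B, ?_⟩
      rintro r ⟨η, hη, rfl⟩
      rw [JJ_set hη.2.2.1]; exact hB η hη
  rw [e]
  constructor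
  · rintro ⟨B, hB⟩
    obtain ⟨C, hC, h⟩ := hφ.lower
    exact ⟨_, hB.change isNormN_norm hC h⟩
  · rintro ⟨B, hB⟩
    obtain ⟨C, hC, h⟩ := hφ.upper
    exact ⟨_, hB.change hφ hC h⟩

lemma exists_cutoff {K A : Set (Rn n)} (hK : IsCompact K) (hA : IsOpen A) (h : K ⊆ A) :
    ∃ ψ : Rn n → ℝ, ContDiff ℝ 1 ψ ∧ HasCompactSupport ψ ∧ tsupport ψ ⊆ A ∧
      (∀ x, 0 ≤ ψ x ∧ ψ x ≤ 1) ∧ ∀ x ∈ K, ∀ᶠ y in nhds x, ψ y = 1 := by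
  obtain ⟨V, h1, h2, h3, h4⟩ := exists_open_between_and_isCompact_closure hK hA h
  obtain ⟨f, hf1, hf0, hf⟩ := exists_contMDiffMap_one_nhds_of_subset_interior
    (modelWithCornersSelf ℝ (Rn n)) (n := 1) (s := K) (t := V) hK.isClosed
    (by rwa [h1.interior_eq])
  have hts : tsupport f ⊆ closure V := closure_mono fun x hx => by
    by_contra h'; exact hx (hf0 x h')
  refine ⟨f, f.contMDiff.contDiff, h4.of_isClosed_subset (isClosed_tsupport _) hts,
    hts.trans h3, fun x => hf x, fun x hx => ?_⟩
  exact (eventually_nhdsSet_iff_forall.1 hf1) x hx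

end norms

open MeasureTheory Set Filter

def MinU {n : ℕ} (φ : Rn n → ℝ) (Ω : Set (Rn n)) (g : Rn n → ℝ) : Prop :=
  ∀ A, CpCtd A Ω → ∀ v, BVlocFun Ω v → CptSupp A (fun x => g x - v x) →
    ∀ B, UB φ A v B → UB φ A g B

def QQ {n : ℕ} (φ : Rn n → ℝ) (Ω : Set (Rn n)) (C : ℝ) (g : Rn n → ℝ) : Prop :=
  ∀ ψ : Rn n → ℝ, ContDiff ℝ 1 ψ → HasCompactSupport ψ → tsupport ψ ⊆ Ω →
    (∀ x, 0 ≤ ψ x ∧ ψ x ≤ 1) → ∀ v, BVlocFun Ω v → ∀ B,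
    (∀ η, Fld η → (∀ x, φ (η x) ≤ ψ x) → JJ v η ≤ B) →
    ∀ η, Fld η → (∀ x, φ (η x) ≤ ψ x) →
      JJ g η ≤ B + C * ∫ x, |g x - v x| * ‖fderiv ℝ ψ x‖

section minimality
variable {n : ℕ} {φ : Rn n → ℝ} {Φ : Rn1 n → ℝ} {Ω : Set (Rn n)}

lemma G_ub (hφ : IsNormN φ) (hcyl : Cylindrical Φ φ) (hΩ : IsOpen Ω) {A : Set (Rn n)}
    (hA : CpCtd A Ω) {v : Rn n → ℝ} (hv : LI Ω v) (B : ℝ) :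
    UB φ A v B ↔ B + volume.real A ∈ upperBounds (Gset Φ A v) := by
  have hAΩ : A ⊆ Ω := subset_closure.trans hA.2.2
  have key : ∀ (η : Rn n → Rn n) (b : Rn n → ℝ), Fld η → tsupport η ⊆ A → Continuous b →
      HasCompactSupport b →
      ∫ x in A, (v x * divN η x + b x) = JJ v η + ∫ x in A, b x := by
    intro η b h1 h2 h3 h4
    rw [integral_add (hv.integrable_div hΩ h1 (h2.trans hAΩ)).integrableOn
      (h3.integrable_of_hasCompactSupport h4).integrableOn, JJ_set h2]
  constructor
  · intro h
    rintro r ⟨η, h1, h2, h3, h4, rfl⟩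
    have hs : tsupport (fun y => (η y).1) ⊆ tsupport η := by
      refine closure_mono fun x hx => ?_
      simp only [Function.mem_support] at hx ⊢
      intro h0; exact hx (by simp [h0])
    have hf : Fld (fun y => (η y).1) := ⟨contDiff_fst.comp h1,
      h2.isCompact.of_isClosed_subset (isClosed_tsupport _) hs⟩
    have h2' : HasCompactSupport fun y => (η y).2 := h2.comp_left (g := Prod.snd) rfl
    rw [key _ (fun y => (η y).2) hf (hs.trans h3) (continuous_snd.comp h1.continuous) h2']
    refine add_le_add (h _ ⟨hf.1, hf.2, hs.trans h3, fun x => ?_⟩) ?_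
    · have := h4 x
      rw [hcyl] at this
      exact (le_max_left _ _).trans this
    · have h5 : ∀ x, ‖(η x).2‖ ≤ 1 := fun x => by
        have := h4 x
        rw [hcyl] at this
        exact (le_max_right _ _).trans this
      have := norm_setIntegral_le_of_norm_le_const (s := A) (μ := volume)
        (f := fun x => (η x).2) (C := 1) hA.finite (fun x _ => h5 x)
      rw [one_mul] at this
      exact (le_abs_self _).trans this
  · intro h η hη
    refine le_of_forall_pos_le_add fun δ hδ => ?_
    obtain ⟨K, hKA, hK, hK'⟩ := hA.1.measurableSet.exists_isCompact_lt_add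
      (μ := volume) hA.finite.ne (ε := ENNReal.ofReal δ) (by simpa using hδ)
    obtain ⟨χ, c1, c2, c3, c4, c5⟩ := exists_cutoff hK hA.1 hKA
    have hm : Function.support (fun x => (η x, χ x)) ⊆
        Function.support η ∪ Function.support χ := by
      intro x hx
      by_contra h0
      simp only [mem_union, Function.mem_support, not_or, not_not] at h0
      exact hx (by simp [h0.1, h0.2])
    have hts : tsupport (fun x => (η x, χ x)) ⊆ tsupport η ∪ tsupport χ := by
      have := closure_mono hm
      rwa [closure_union] at this
    have := h ⟨fun x => (η x, χ x), hη.1.prodMk c1,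
      (hη.2.1.isCompact.union c2.isCompact).of_isClosed_subset (isClosed_tsupport _) hts,
      hts.trans (union_subset hη.2.2.1 c3), fun x => ?_, rfl⟩
    · simp only at this
      rw [key _ _ hη.fld hη.2.2.1 c1.continuous c2] at this
      have hKi : volume.real K ≤ ∫ x in A, χ x := by
        have e1 : volume.real K = ∫ x in K, χ x := by
          rw [setIntegral_congr_fun hK.measurableSet (g := fun _ => (1:ℝ))
            (fun x hx => (c5 x hx).self_of_nhds)]
          simp
        rw [e1]
        exact setIntegral_mono_set (c1.continuous.integrable_of_hasCompactSupport c2).integrableOn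
          (ae_of_all _ fun x => (c4 x).1) hKA.eventuallyLE
      have hAK : volume.real A ≤ volume.real K + δ := by
        have hKf : volume K ≠ ⊤ := hK.measure_lt_top.ne
        have := ENNReal.toReal_mono (by simp [hKf]) hK'.le
        rw [ENNReal.toReal_add hKf (by simp), ENNReal.toReal_ofReal hδ.le] at this
        exact this
      linarith
    · rw [hcyl]
      refine max_le (hη.2.2.2 x) ?_
      rw [abs_of_nonneg (c4 x).1]; exact (c4 x).2

lemma minG_iff (hφ : IsNormN φ) (hcyl : Cylindrical Φ φ) (hΩ : IsOpen Ω) {g : Rn n → ℝ} :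
    MinG Φ Ω g ↔ BVlocFun Ω g ∧ MinU φ Ω g := by
  refine and_congr_right fun hg => ?_
  have hne : ∀ A v, (Gset Φ A v).Nonempty := fun A v =>
    ⟨_, fun _ => 0, contDiff_const, HasCompactSupport.zero, by
      simp, fun x => by rw [hcyl]; simp [hφ.zero], rfl⟩
  have hg' := (bvloc_iff hφ).1 hg
  constructor
  · intro h A hA v hv hc B hB
    have hv' := (bvloc_iff hφ).1 hv
    have h1 := h A hA v hv hc
    rw [G_ub hφ hcyl hΩ hA hg'.1]
    rw [G_ub hφ hcyl hΩ hA hv'.1] at hB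
    obtain ⟨B', hB'⟩ := hg'.2 A hA
    rw [G_ub hφ hcyl hΩ hA hg'.1] at hB'
    intro r hr
    exact (le_csSup ⟨_, hB'⟩ hr).trans (h1.trans (csSup_le (hne _ _) hB))
  · intro h A hA v hv hc
    have hv' := (bvloc_iff hφ).1 hv
    obtain ⟨B', hB'⟩ := hv'.2 A hA
    rw [G_ub hφ hcyl hΩ hA hv'.1] at hB'
    refine csSup_le (hne _ _) ?_
    have := h A hA v hv hc (Gfun Φ v A - volume.real A) (by
      rw [G_ub hφ hcyl hΩ hA hv'.1]
      intro r hr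
      rw [sub_add_cancel]
      exact le_csSup ⟨_, hB'⟩ hr)
    rw [G_ub hφ hcyl hΩ hA hg'.1, sub_add_cancel] at this
    exact this

lemma MinU.neg (hφ : IsNormN φ) {g : Rn n → ℝ} (h : MinU φ Ω g) : MinU φ Ω (fun x => - g x) := by
  have flip : ∀ {A : Set (Rn n)} {v : Rn n → ℝ} {B : ℝ}, UB φ A v B → UB φ A (fun x => - v x) B := by
    intro A v B hB η hη
    have ht : TestN A φ (fun x => (-1 : ℝ) • η x) := by
      refine ⟨(hη.fld.const_smul _).1, (hη.fld.const_smul _).2,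
        (tsupport_smul_sub (a := fun _ => (-1:ℝ))).trans hη.2.2.1, fun x => ?_⟩
      rw [hφ.2.1]; simpa using hη.2.2.2 x
    have := hB _ ht
    rw [JJ_const_smul _ _ hη.fld] at this
    have e := JJ_const_mul (-1) v η
    simp only [neg_mul, one_mul] at e this
    rw [e]; exact this
  intro A hA v hv hc B hB
  have hv' := (bvloc_iff hφ).1 hv
  refine flip (h A hA (fun x => - v x) ?_ ?_ B (flip hB))
  · rw [bvloc_iff hφ]
    refine ⟨fun A hA => (hv'.1 A hA).neg, fun A hA => ?_⟩
    obtain ⟨B, hB⟩ := hv'.2 A hA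
    exact ⟨B, flip hB⟩
  · have : (fun x => g x - - v x) = - (fun x => - g x - v x) := by funext x; simp; ring
    unfold CptSupp at hc ⊢
    rw [this, tsupport_neg]; exact hc

lemma BVlocFun.neg {g : Rn n → ℝ} (h : BVlocFun Ω g) : BVlocFun Ω (fun x => - g x) := by
  rw [bvloc_iff isNormN_norm] at h ⊢
  refine ⟨fun A hA => (h.1 A hA).neg, fun A hA => ?_⟩
  obtain ⟨B, hB⟩ := h.2 A hA
  refine ⟨B, fun η hη => ?_⟩
  have ht : TestN A (fun x => ‖x‖) (fun x => (-1 : ℝ) • η x) := by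
    refine ⟨(hη.fld.const_smul _).1, (hη.fld.const_smul _).2,
      (tsupport_smul_sub (a := fun _ => (-1:ℝ))).trans hη.2.2.1, fun x => ?_⟩
    simpa using hη.2.2.2 x
  have := hB _ ht
  rw [JJ_const_smul _ _ hη.fld] at this
  have e := JJ_const_mul (-1) g η
  simp only [neg_mul, one_mul] at e this
  rw [e]; exact this

/-- Lower-order term estimate. -/
lemma cut_term_le (hΩ : IsOpen Ω) {C : ℝ} (hl : ∀ x, ‖x‖ ≤ C * φ x) (hC : 0 < C) {k ψ : Rn n → ℝ}
    (hk : LI Ω k)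
    (hψ : ContDiff ℝ 1 ψ) (hψc : HasCompactSupport ψ) (hψs : tsupport ψ ⊆ Ω)
    {η : Rn n → Rn n} (h : Fld η) (hη : ∀ x, φ (η x) ≤ 1) :
    ∫ x, k x * fderiv ℝ ψ x (η x) ≤ C * ∫ x, |k x| * ‖fderiv ℝ ψ x‖ := by
  rw [← integral_const_mul]
  have hc := hψ.continuous_fderiv (by norm_num)
  have hs := tsupport_fderiv_subset ℝ (f := ψ)
  have hcs : HasCompactSupport (fderiv ℝ ψ) := hψc.fderiv ℝ
  have hsub : tsupport (fun x => fderiv ℝ ψ x (η x)) ⊆ tsupport (fderiv ℝ ψ) := by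
    refine closure_mono fun x hx => ?_
    simp only [Function.mem_support] at hx ⊢
    intro h0; exact hx (by simp [h0])
  refine integral_mono ?_ ?_ ?_
  · exact hk.integrable_mul hΩ (hc.clm_apply h.1.continuous)
      (hcs.isCompact.of_isClosed_subset (isClosed_tsupport _) hsub) ((hsub.trans hs).trans hψs)
  · refine Integrable.const_mul ?_ C
    refine LI.integrable_mul (g := fun x => |k x|) hΩ (fun A hA => (hk A hA).abs) hc.norm hcs.norm ?_
    refine Subset.trans (closure_mono fun x hx => ?_) (hs.trans hψs)
    simpa using hx
  · intro x
    calc k x * fderiv ℝ ψ x (η x) ≤ |k x * fderiv ℝ ψ x (η x)| := le_abs_self _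
      _ = |k x| * ‖fderiv ℝ ψ x (η x)‖ := by rw [abs_mul, Real.norm_eq_abs]
      _ ≤ |k x| * (‖fderiv ℝ ψ x‖ * (C * 1)) := by
          gcongr
          refine (ContinuousLinearMap.le_opNorm _ _).trans ?_
          gcongr
          exact (hl _).trans (by gcongr; exact hη x)
      _ = C * (|k x| * ‖fderiv ℝ ψ x‖) := by ring

lemma MinU.toQQ (hφ : IsNormN φ) (hΩ : IsOpen Ω) {C : ℝ} (hl : ∀ x, ‖x‖ ≤ C * φ x) (hC : 0 < C)
    {g : Rn n → ℝ} (hg : BVlocFun Ω g) (h : MinU φ Ω g) : QQ φ Ω C g := by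
  intro ψ hψ hψc hψs hψ01 v hv B hB η₀ hη₀ hηψ₀
  have hg' := (bvloc_iff hφ).1 hg
  have hv' := (bvloc_iff hφ).1 hv
  have hψ' : ContDiff ℝ 1 (fun x => 1 - ψ x) := contDiff_const.sub hψ
  have hψb : ∀ x, |ψ x| ≤ 1 := fun x => abs_le.2 ⟨by linarith [(hψ01 x).1], (hψ01 x).2⟩
  have hψb' : ∀ x, |1 - ψ x| ≤ 1 := fun x => abs_le.2 ⟨by linarith [(hψ01 x).2], by
    linarith [(hψ01 x).1]⟩
  set R := C * ∫ x, |g x - v x| * ‖fderiv ℝ ψ x‖ with hR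
  have hw : LI Ω (fun x => ψ x * v x + (1 - ψ x) * g x) :=
    (hv'.1.mul_bdd hψ.continuous 1 hψb).add (hg'.1.mul_bdd hψ'.continuous 1 hψb')
  have t1 : ∀ {A η}, TestN A φ η → TestN A φ (fun x => ψ x • η x) := by
    intro A η hη
    refine ⟨(hη.fld.smul hψ).1, (hη.fld.smul hψ).2, tsupport_smul_sub.trans hη.2.2.1, fun x => ?_⟩
    rw [hφ.smul (hψ01 x).1]
    exact mul_le_one₀ (hψ01 x).2 (hφ.nonneg _) (hη.2.2.2 x)
  have t2 : ∀ {A η}, TestN A φ η → TestN A φ (fun x => (1 - ψ x) • η x) := by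
    intro A η hη
    refine ⟨(hη.fld.smul hψ').1, (hη.fld.smul hψ').2, tsupport_smul_sub.trans hη.2.2.1,
      fun x => ?_⟩
    rw [hφ.smul (by linarith [(hψ01 x).2])]
    exact mul_le_one₀ (by linarith [(hψ01 x).1]) (hφ.nonneg _) (hη.2.2.2 x)
  have hbv : BVlocFun Ω (fun x => ψ x * v x + (1 - ψ x) * g x) := by
    rw [bvloc_iff hφ]
    refine ⟨hw, fun A hA => ?_⟩
    obtain ⟨B1, h1⟩ := hv'.2 A hA
    obtain ⟨B2, h2⟩ := hg'.2 A hA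
    refine ⟨B1 + B2 + R, fun η hη => ?_⟩
    rw [JJ_cut hΩ hv'.1 hg'.1 hψ hη.fld (hη.2.2.1.trans (subset_closure.trans hA.2.2))]
    exact add_le_add (add_le_add (h1 _ (t1 hη)) (h2 _ (t2 hη)))
      (cut_term_le hΩ hl hC (hg'.1.sub hv'.1) hψ hψc hψs hη.fld hη.2.2.2)
  obtain ⟨A, hA, hKA⟩ := exists_cp hψc.isCompact hΩ hψs
  have hAΩ : A ⊆ Ω := subset_closure.trans hA.2.2
  let S : Set ℝ := {r | ∃ η, Fld η ∧ tsupport η ⊆ A ∧ (∀ x, φ (η x) ≤ 1 - ψ x) ∧ r = JJ g η}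
  have hSne : S.Nonempty := ⟨_, fun _ => 0, fld_zero, by simp, fun x => by
    rw [hφ.zero]; linarith [(hψ01 x).2], rfl⟩
  have hSb : BddAbove S := by
    obtain ⟨B2, h2⟩ := hg'.2 A hA
    refine ⟨B2, ?_⟩
    rintro r ⟨η, a1, a2, a3, rfl⟩
    exact h2 η ⟨a1.1, a1.2, a2, fun x => (a3 x).trans (by linarith [(hψ01 x).1])⟩
  have hUB : UB φ A (fun x => ψ x * v x + (1 - ψ x) * g x) (B + sSup S + R) := by
    intro η hη
    rw [JJ_cut hΩ hv'.1 hg'.1 hψ hη.fld (hη.2.2.1.trans hAΩ)]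
    refine add_le_add (add_le_add ?_ ?_)
      (cut_term_le hΩ hl hC (hg'.1.sub hv'.1) hψ hψc hψs hη.fld hη.2.2.2)
    · refine hB _ (hη.fld.smul hψ) fun x => ?_
      rw [hφ.smul (hψ01 x).1]
      exact mul_le_of_le_one_right (hψ01 x).1 (hη.2.2.2 x)
    · refine le_csSup hSb ⟨_, (hη.fld.smul hψ'), (t2 hη).2.2.1, fun x => ?_, rfl⟩
      have : 0 ≤ 1 - ψ x := by linarith [(hψ01 x).2]
      rw [hφ.smul this]
      exact mul_le_of_le_one_right this (hη.2.2.2 x)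
  have hcp : CptSupp A (fun x => g x - (ψ x * v x + (1 - ψ x) * g x)) := by
    have hs : tsupport (fun x => g x - (ψ x * v x + (1 - ψ x) * g x)) ⊆ tsupport ψ := by
      refine closure_mono fun x hx => ?_
      simp only [Function.mem_support] at hx ⊢
      intro h0; exact hx (by simp [h0])
    exact ⟨hψc.isCompact.of_isClosed_subset (isClosed_tsupport _) hs, hs.trans hKA⟩
  have hfin := h A hA _ hbv hcp _ hUB
  have hs0 : tsupport η₀ ⊆ A := (tsupport_sub_of hφ hηψ₀).trans hKA
  have : sSup S ≤ B + sSup S + R - JJ g η₀ := by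
    refine csSup_le hSne ?_
    rintro r ⟨η, a1, a2, a3, rfl⟩
    have := hfin (fun x => η₀ x + η x) ⟨(hη₀.add a1).1, (hη₀.add a1).2, tsupport_add_sub hs0 a2,
      fun x => (hφ.add _ _).trans (by linarith [hηψ₀ x, a3 x])⟩
    rw [JJ_add_field hΩ hg'.1 hη₀ a1 (hs0.trans hAΩ) (a2.trans hAΩ)] at this
    linarith
  linarith

lemma QQ.toMinU (hφ : IsNormN φ) {C : ℝ}
    {g : Rn n → ℝ} (h : QQ φ Ω C g) : MinU φ Ω g := by
  intro A hA v hv hc B hB η hη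
  have hAΩ : A ⊆ Ω := subset_closure.trans hA.2.2
  obtain ⟨ψ, c1, c2, c3, c4, c5⟩ := exists_cutoff (hc.1.union hη.2.1.isCompact) hA.1
    (union_subset hc.2 hη.2.2.1)
  have := h ψ c1 c2 (c3.trans hAΩ) c4 v hv B (fun η' h1 h2 => hB η' ⟨h1.1, h1.2,
    (tsupport_sub_of hφ h2).trans c3, fun x => (h2 x).trans (c4 x).2⟩) η hη.fld (fun x => by
      by_cases hx : x ∈ tsupport η
      · rw [(c5 x (Or.inr hx)).self_of_nhds]; exact hη.2.2.2 x
      · rw [image_eq_zero_of_notMem_tsupport hx, hφ.zero]; exact (c4 x).1)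
  have e : ∀ x, |g x - v x| * ‖fderiv ℝ ψ x‖ = 0 := by
    intro x
    by_cases hx : x ∈ tsupport (fun x => g x - v x)
    · have h1 : ψ =ᶠ[nhds x] fun _ => 1 := c5 x (Or.inl hx)
      rw [h1.fderiv_eq]; simp
    · have : g x - v x = 0 := image_eq_zero_of_notMem_tsupport (f := fun x => g x - v x) hx
      rw [this]; simp
  simpa [e] using this

lemma QQ.bound (hφ : IsNormN φ) (hΩ : IsOpen Ω) {C : ℝ}
    {g : Rn n → ℝ} (hg : LI Ω g) (h : QQ φ Ω C g) : BVlocFun Ω g := by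
  rw [bvloc_iff hφ]
  refine ⟨hg, fun A hA => ?_⟩
  obtain ⟨ψ, c1, c2, c3, c4, c5⟩ := exists_cutoff hA.2.1 hΩ hA.2.2
  have h0 : BVlocFun Ω (fun _ => (0:ℝ)) := by
    rw [bvloc_iff hφ]
    exact ⟨fun A hA => integrableOn_zero, fun A hA => ⟨0, fun η hη => by simp [JJ]⟩⟩
  exact ⟨_, fun η hη => h ψ c1 c2 c3 c4 _ h0 0 (fun _ _ _ => by simp [JJ]) η hη.fld fun x => by
    by_cases hx : x ∈ A
    · rw [(c5 x (subset_closure hx)).self_of_nhds]; exact hη.2.2.2 x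
    · rw [image_eq_zero_of_notMem_tsupport (fun h' => hx (hη.2.2.1 h')), hφ.zero]
      exact (c4 x).1⟩

end minimality

open MeasureTheory Set Filter

noncomputable def moll {n : ℕ} (ρ w : Rn n → ℝ) (x : Rn n) : ℝ := ∫ h, ρ h * w (x - h)

section mollification
variable {n : ℕ}

lemma transl_cont {w : Rn n → ℝ} (hw : Integrable w) {ε : ℝ} (hε : 0 < ε) :
    ∃ δ > 0, ∀ h : Rn n, ‖h‖ < δ → ∫ x, |w (x - h) - w x| ≤ ε := by
  have hw1 : MemLp w 1 volume := memLp_one_iff_integrable.2 hw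
  let τ : Rn n → C(Rn n, Rn n) := fun h => ⟨fun x => x - h, by fun_prop⟩
  have hτ : Continuous τ := ContinuousMap.continuous_of_continuous_uncurry _ (by
    show Continuous (fun p : Rn n × Rn n => p.2 - p.1)
    fun_prop)
  have hmp : ∀ h, MeasurePreserving (τ h) (volume : Measure (Rn n)) volume :=
    fun h => measurePreserving_sub_right volume h
  have : Fact ((1:ENNReal) ≤ 1) := ⟨le_rfl⟩
  have hc := Continuous.compMeasurePreservingLp (p := 1) (E := ℝ)
    (f := fun _ : Rn n => hw1.toLp w) (g := τ) continuous_const hτ hmp (by simp)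
  have h0 := Metric.continuousAt_iff.1 (hc.continuousAt (x := 0)) ε hε
  obtain ⟨δ, hδ, H⟩ := h0
  refine ⟨δ, hδ, fun h hh => ?_⟩
  have := H (x := h) (by simpa using hh)
  refine le_trans (le_of_eq ?_) this.le
  rw [dist_comm, Lp.dist_eq_norm, Lp.toLp_compMeasurePreserving, Lp.toLp_compMeasurePreserving,
    neg_add_eq_sub, ← MemLp.toLp_sub, Lp.norm_toLp]
  rw [eLpNorm_one_eq_lintegral_enorm, integral_eq_lintegral_of_nonneg_ae
    (ae_of_all _ fun x => abs_nonneg _)]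
  · congr 1
    refine lintegral_congr fun x => ?_
    rw [← Real.norm_eq_abs, ofReal_norm_eq_enorm]
    simp [τ]
  · exact ((hw.comp_sub_right h).sub hw).abs.aestronglyMeasurable

lemma conv_int {w ρ : Rn n → ℝ} (hw : Integrable w) (hρ : Integrable ρ) :
    Integrable (fun p : Rn n × Rn n => ρ p.2 * w (p.1 - p.2)) (volume.prod volume) :=
  Integrable.convolution_integrand (ContinuousLinearMap.mul ℝ ℝ) hρ hw

lemma moll_integrable {w ρ : Rn n → ℝ} (hw : Integrable w) (hρ : Integrable ρ) :
    Integrable (moll ρ w) := (conv_int hw hρ).integral_prod_left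

lemma moll_fubini {w ρ b : Rn n → ℝ} (hw : Integrable w) (hρ : Integrable ρ)
    (hb : Continuous b) (hc : HasCompactSupport b) :
    ∫ x, moll ρ w x * b x = ∫ h, ρ h * ∫ x, w (x - h) * b x := by
  obtain ⟨C, hC⟩ := hc.exists_bound_of_continuous hb
  have hi : Integrable (fun p : Rn n × Rn n => (ρ p.2 * w (p.1 - p.2)) * b p.1)
      (volume.prod volume) :=
    (conv_int hw hρ).mul_bdd (c := C) (hb.comp continuous_fst).aestronglyMeasurable
      (ae_of_all _ fun p => hC p.1)
  have e := integral_integral_swap (f := fun x h => (ρ h * w (x - h)) * b x) hi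
  simp only [moll, ← integral_mul_const, ← integral_const_mul]
  rw [e]
  simp only [mul_assoc]

lemma moll_l1 {w ρ : Rn n → ℝ} (hw : Integrable w) (hρ : Integrable ρ) (h0 : ∀ h, 0 ≤ ρ h)
    (h1 : ∫ h, ρ h = 1) {ε δ : ℝ} (hδ : ∀ h, ‖h‖ < δ → ∫ x, |w (x - h) - w x| ≤ ε)
    (hs : ∀ h, δ ≤ ‖h‖ → ρ h = 0) : ∫ x, |moll ρ w x - w x| ≤ ε := by
  have i1 := conv_int hw hρ
  have i2 : Integrable (fun p : Rn n × Rn n => ρ p.2 * w p.1) (volume.prod volume) := by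
    have := hw.mul_prod hρ
    refine this.congr (ae_of_all _ fun p => ?_)
    simp [mul_comm]
  have i3 := (i1.sub i2).abs
  have i3' : Integrable (fun p : Rn n × Rn n => ρ p.2 * |w (p.1 - p.2) - w p.1|)
      (volume.prod volume) := by
    refine i3.congr (ae_of_all _ fun p => ?_)
    simp only [Pi.sub_apply]
    rw [← mul_sub, abs_mul, abs_of_nonneg (h0 _)]
  calc ∫ x, |moll ρ w x - w x| ≤ ∫ x, ∫ h, ρ h * |w (x - h) - w x| := by
        refine integral_mono_ae ((moll_integrable hw hρ).sub hw).abs i3'.integral_prod_left ?_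
        filter_upwards [i1.prod_right_ae] with x hx
        have e : moll ρ w x - w x = ∫ h, ρ h * (w (x - h) - w x) := by
          simp only [mul_sub]
          rw [integral_sub hx (hρ.mul_const _), integral_mul_const, h1, one_mul]; rfl
        rw [e]
        refine (abs_integral_le_integral_abs).trans (le_of_eq ?_)
        congr 1; funext h; rw [abs_mul, abs_of_nonneg (h0 _)]
    _ = ∫ h, ρ h * ∫ x, |w (x - h) - w x| := by
        rw [integral_integral_swap (f := fun x h => ρ h * |w (x - h) - w x|) i3']
        simp only [integral_const_mul]
    _ ≤ ∫ h, ρ h * ε := by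
        refine integral_mono ?_ (hρ.mul_const _) fun h => ?_
        · have := i3'.integral_prod_right
          simpa only [integral_const_mul] using this
        · by_cases hh : ‖h‖ < δ
          · exact mul_le_mul_of_nonneg_left (hδ h hh) (h0 h)
          · simp [hs h (not_lt.1 hh)]
    _ = ε := by rw [integral_mul_const, h1, one_mul]

lemma moll_exists {w : Rn n → ℝ} (hw : Integrable w) {ε δ : ℝ} (hε : 0 < ε) (hδ : 0 < δ) :
    ∃ ρ : Rn n → ℝ, Continuous ρ ∧ Integrable ρ ∧ (∀ h, 0 ≤ ρ h) ∧ ∫ h, ρ h = 1 ∧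
      (∀ h, δ ≤ ‖h‖ → ρ h = 0) ∧ ContDiff ℝ 2 (moll ρ w) ∧ ∫ x, |moll ρ w x - w x| ≤ ε := by
  obtain ⟨δ', hδ', H⟩ := transl_cont hw hε
  have hm : 0 < min δ δ' := lt_min hδ hδ'
  let f : ContDiffBump (0 : Rn n) := ⟨min δ δ' / 2, min δ δ', by linarith, by linarith⟩
  have hz : ∀ h : Rn n, min δ δ' ≤ ‖h‖ → f.normed volume h = 0 := by
    intro h hh
    have : h ∉ Function.support (f.normed volume) := by
      rw [f.support_normed_eq]
      simp only [Metric.mem_ball, dist_zero_right, not_lt]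
      exact hh
    simpa using this
  refine ⟨f.normed volume, f.continuous_normed, f.integrable_normed, f.nonneg_normed,
    f.integral_normed, fun h hh => hz h ((min_le_left _ _).trans hh), ?_, ?_⟩
  · exact f.hasCompactSupport_normed.contDiff_convolution_left (n := 2) (ContinuousLinearMap.mul ℝ ℝ)
      f.contDiff_normed hw.locallyIntegrable
  · exact moll_l1 hw f.integrable_normed f.nonneg_normed f.integral_normed H
      fun h hh => hz h ((min_le_right _ _).trans hh)

end mollification

open MeasureTheory Set Filter

section additivity
variable {n : ℕ} {φ : Rn n → ℝ} {Ω : Set (Rn n)}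

lemma UB.nonneg (hφ : IsNormN φ) {A : Set (Rn n)} {v : Rn n → ℝ} {B : ℝ} (h : UB φ A v B) :
    0 ≤ B := by
  have := h (fun _ => 0) ⟨contDiff_const, HasCompactSupport.zero, by simp, fun x => by
    simp [hφ.zero]⟩
  simpa [JJ, divN_zero] using this

lemma divN_transl {η : Rn n → Rn n} (h x : Rn n) :
    divN (fun y => η (y + h)) x = divN η (x + h) := by
  unfold divN; rw [fderiv_comp_add_right]

lemma UB_moll (hφ : IsNormN φ) {A : Set (Rn n)} {w ρ : Rn n → ℝ} (hw : Integrable w)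
    (hρ : Integrable ρ) (h0 : ∀ h, 0 ≤ ρ h) (h1 : ∫ h, ρ h = 1) {δ : ℝ}
    (hs : ∀ h, δ ≤ ‖h‖ → ρ h = 0) {η : Rn n → Rn n} (hη : Fld η)
    (hδ : ∀ h x, ‖h‖ < δ → x + h ∈ tsupport η → x ∈ A) {L : ℝ} (hL : 0 < L)
    (hηL : ∀ x, φ (η x) ≤ L) {B : ℝ} (hB : UB φ A w B) :
    ∫ x, moll ρ w x * divN η x ≤ L * B := by
  rw [moll_fubini hw hρ (divN_continuous hη.1) hη.divN_compact]
  have key : ∀ h, ‖h‖ < δ → ∫ x, w (x - h) * divN η x ≤ L * B := by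
    intro h hh
    have e : ∫ x, w (x - h) * divN η x = JJ w (fun y => η (y + h)) := by
      unfold JJ
      rw [← integral_add_right_eq_self (fun x => w (x - h) * divN η x) h]
      simp only [divN_transl, add_sub_cancel_right]
    have hf : Fld (fun y => η (y + h)) :=
      ⟨hη.1.comp (contDiff_id.add contDiff_const), hη.2.comp_homeomorph (Homeomorph.addRight h)⟩
    have ht : TestN A φ (fun x => L⁻¹ • η (x + h)) := by
      refine ⟨(hf.const_smul _).1, (hf.const_smul _).2, ?_, fun x => ?_⟩
      · refine (tsupport_smul_sub (a := fun _ => L⁻¹)).trans ?_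
        have := tsupport_comp_eq_preimage η (Homeomorph.addRight h)
        intro x hx
        refine hδ h x hh ?_
        have hx' : x ∈ tsupport (η ∘ ⇑(Homeomorph.addRight h)) := hx
        rw [this] at hx'
        exact hx'
      · rw [hφ.smul (by positivity), inv_mul_le_iff₀ hL, mul_one]; exact hηL _
    have := hB _ ht
    rw [JJ_const_smul _ _ hf, inv_mul_le_iff₀ hL] at this
    rw [e]; exact this
  by_cases hi : Integrable (fun h => ρ h * ∫ x, w (x - h) * divN η x)
  · calc _ ≤ ∫ h, ρ h * (L * B) := by
          refine integral_mono hi (hρ.mul_const _) fun h => ?_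
          by_cases hh : ‖h‖ < δ
          · exact mul_le_mul_of_nonneg_left (key h hh) (h0 h)
          · simp [hs h (not_lt.1 hh)]
      _ = L * B := by rw [integral_mul_const, h1, one_mul]
  · rw [integral_undef hi]
    have := hB.nonneg hφ
    positivity

lemma deriv_lip {f : ℝ → ℝ} (hf : Differentiable ℝ f) {L : ℝ}
    (hd : ∀ t, 0 ≤ deriv f t ∧ deriv f t ≤ L) (a b : ℝ) : |f a - f b| ≤ L * |a - b| := by
  have := convex_univ.norm_image_sub_le_of_norm_deriv_le (f := f) (C := L) (x := b) (y := a)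
    (fun x _ => hf x) (fun x _ => by
      rw [Real.norm_eq_abs, abs_of_nonneg (hd x).1]; exact (hd x).2) (mem_univ _) (mem_univ _)
  simpa using this

lemma lip_LI {f : ℝ → ℝ} (hf : Continuous f) {L : ℝ} (hL : ∀ a b, |f a - f b| ≤ L * |a - b|)
    {w : Rn n → ℝ} (hw : LI Ω w) : LI Ω (fun x => f (w x)) := by
  intro A hA
  have h1 : IntegrableOn (fun x => L * |w x| + |f 0|) A :=
    ((hw A hA).abs.const_mul L).add (integrableOn_const hA.finite.ne)
  refine Integrable.mono' h1 (hf.comp_aestronglyMeasurable (hw A hA).aestronglyMeasurable) ?_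
  refine ae_of_all _ fun x => ?_
  have := hL (w x) 0
  rw [Real.norm_eq_abs]
  have h2 := abs_add_le (f (w x) - f 0) (f 0)
  simp only [sub_add_cancel, sub_zero] at h2 this
  linarith

lemma LI_of_integrable {w : Rn n → ℝ} (hw : Integrable w) : LI Ω w := fun _ _ => hw.integrableOn

lemma chain_identity {f : ℝ → ℝ} (hf : ContDiff ℝ 2 f) (L : ℝ) {m : Rn n → ℝ}
    (hm : ContDiff ℝ 2 m) {η1 η2 : Rn n → Rn n} (h1 : Fld η1) (h2 : Fld η2) :
    Fld (fun x => deriv f (m x) • η1 x + (L - deriv f (m x)) • η2 x) ∧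
    ∫ x, (f (m x) * divN η1 x + (L * m x - f (m x)) * divN η2 x) =
      ∫ x, m x * divN (fun x => deriv f (m x) • η1 x + (L - deriv f (m x)) • η2 x) x := by
  have hf' : ContDiff ℝ 1 (deriv f) := by
    have h2 : ContDiff ℝ (1 + 1) f := by convert hf using 1; norm_num
    exact (contDiff_succ_iff_deriv.1 h2).2.2
  have hm1 : ContDiff ℝ 1 m := hm.of_le (by norm_num)
  have hf1 : ContDiff ℝ 1 f := hf.of_le (by norm_num)
  have a1 : ContDiff ℝ 1 (fun x => deriv f (m x)) := hf'.comp hm1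
  have a2 : ContDiff ℝ 1 (fun x => L - deriv f (m x)) := contDiff_const.sub a1
  have hF : Fld (fun x => deriv f (m x) • η1 x + (L - deriv f (m x)) • η2 x) :=
    (h1.smul a1).add (h2.smul a2)
  refine ⟨hF, ?_⟩
  have b1 : ContDiff ℝ 1 (fun x => f (m x)) := hf1.comp hm1
  have b2 : ContDiff ℝ 1 (fun x => L * m x - f (m x)) := (contDiff_const.mul hm1).sub b1
  have X1 := h1.smul b1
  have X2 := h2.smul b2
  have X3 := hF.smul hm1
  have ci : ∀ {η : Rn n → Rn n}, Fld η → Integrable (divN η) := fun h =>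
    (divN_continuous h.1).integrable_of_hasCompactSupport h.divN_compact
  have si : ∀ {a : Rn n → ℝ} {η : Rn n → Rn n}, ContDiff ℝ 1 a → Fld η →
      Integrable (fun x => a x * divN η x) := fun ha h =>
    (ha.continuous.mul (divN_continuous h.1)).integrable_of_hasCompactSupport
      h.divN_compact.mul_left
  have e : ∀ x, f (m x) * divN η1 x + (L * m x - f (m x)) * divN η2 x -
      m x * divN (fun x => deriv f (m x) • η1 x + (L - deriv f (m x)) • η2 x) x =
      divN (fun x => f (m x) • η1 x) x + divN (fun x => (L * m x - f (m x)) • η2 x) x -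
      divN (fun x => m x • (deriv f (m x) • η1 x + (L - deriv f (m x)) • η2 x)) x := by
    intro x
    rw [divN_smul (b1.differentiable (by norm_num)) h1.diff,
      divN_smul (b2.differentiable (by norm_num)) h2.diff,
      divN_smul (hm1.differentiable (by norm_num)) hF.diff]
    have d0 := (hm1.differentiable (by norm_num) x).hasFDerivAt
    have d1 : HasFDerivAt (fun x => f (m x)) (deriv f (m x) • fderiv ℝ m x) x :=
      (hf1.differentiable (by norm_num) (m x)).hasDerivAt.comp_hasFDerivAt x d0
    have d2 : HasFDerivAt (fun x => L * m x - f (m x))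
        (L • fderiv ℝ m x - deriv f (m x) • fderiv ℝ m x) x := (d0.const_mul L).sub d1
    rw [d1.fderiv, d2.fderiv]
    simp
    ring
  have si12 : Integrable (fun x => f (m x) * divN η1 x + (L * m x - f (m x)) * divN η2 x) :=
    (si b1 h1).add (si b2 h2)
  have ci12 : Integrable (fun x => divN (fun x => f (m x) • η1 x) x +
      divN (fun x => (L * m x - f (m x)) • η2 x) x) := (ci X1).add (ci X2)
  rw [← sub_eq_zero, ← integral_sub si12 (si hm1 hF)]
  simp only [e]
  rw [integral_sub ci12 (ci X3), integral_add (ci X1) (ci X2), integral_divN X1,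
    integral_divN X2, integral_divN X3]
  simp

lemma additivity (hφ : IsNormN φ) {A : Set (Rn n)} (hA : IsOpen A) {w : Rn n → ℝ}
    (hw : Integrable w) {f : ℝ → ℝ} (hf : ContDiff ℝ 2 f) {L : ℝ} (hL : 0 < L)
    (hd : ∀ t, 0 ≤ deriv f t ∧ deriv f t ≤ L) {B : ℝ} (hB : UB φ A w B)
    {η1 η2 : Rn n → Rn n} (h1 : TestN A φ η1) (h2 : TestN A φ η2) :
    JJ (fun x => f (w x)) η1 + JJ (fun x => L * w x - f (w x)) η2 ≤ L * B := by
  have hlip := deriv_lip (hf.differentiable (by norm_num)) hd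
  obtain ⟨C1, hC1⟩ := h1.fld.divN_compact.exists_bound_of_continuous (divN_continuous h1.1)
  obtain ⟨C2, hC2⟩ := h2.fld.divN_compact.exists_bound_of_continuous (divN_continuous h2.1)
  have hC10 : 0 ≤ C1 := (norm_nonneg _).trans (hC1 0)
  have hC20 : 0 ≤ C2 := (norm_nonneg _).trans (hC2 0)
  set D := L * C1 + 2 * L * C2 with hD
  have hD0 : 0 ≤ D := by positivity
  obtain ⟨δ, hδ0, hδ⟩ := (h1.2.1.isCompact.union h2.2.1.isCompact).exists_thickening_subset_open hA
    (union_subset h1.2.2.1 h2.2.2.1)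
  have gi : ∀ {m : Rn n → ℝ}, Integrable m → Integrable (fun x => f (m x) * divN η1 x +
      (L * m x - f (m x)) * divN η2 x) := by
    intro m hm
    have l1 : LI univ m := LI_of_integrable hm
    have l2 := lip_LI hf.continuous hlip l1
    exact (l2.integrable_div isOpen_univ h1.fld (subset_univ _)).add
      (((l1.const_mul L).sub l2).integrable_div isOpen_univ h2.fld (subset_univ _))
  have e0 : JJ (fun x => f (w x)) η1 + JJ (fun x => L * w x - f (w x)) η2 =
      ∫ x, (f (w x) * divN η1 x + (L * w x - f (w x)) * divN η2 x) := by
    have l1 : LI univ w := LI_of_integrable hw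
    have l2 := lip_LI hf.continuous hlip l1
    unfold JJ
    rw [integral_add (l2.integrable_div isOpen_univ h1.fld (subset_univ _))
      (((l1.const_mul L).sub l2).integrable_div isOpen_univ h2.fld (subset_univ _))]
  rw [e0]
  refine le_of_forall_pos_le_add fun ε hε => ?_
  obtain ⟨ρ, r1, r2, r3, r4, r5, r6, r7⟩ := moll_exists hw
    (show 0 < ε / (D + 1) by positivity) hδ0
  have mi := moll_integrable hw r2
  obtain ⟨hF, hId⟩ := chain_identity hf L r6 h1.fld h2.fld
  have step := UB_moll hφ hw r2 r3 r4 r5 hF (A := A) (by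
    intro h x hh hx
    have hx' : x + h ∈ tsupport η1 ∪ tsupport η2 := by
      refine tsupport_add_sub ?_ ?_ hx
      · exact tsupport_smul_sub.trans subset_union_left
      · exact tsupport_smul_sub.trans subset_union_right
    refine hδ (Metric.mem_thickening_iff.2 ⟨x + h, hx', ?_⟩)
    simpa [dist_eq_norm] using hh) hL (fun x => by
    have hx := hd (moll ρ w x)
    refine (hφ.add _ _).trans ?_
    rw [hφ.smul hx.1, hφ.smul (by linarith [hx.2])]
    have q1 := mul_le_mul_of_nonneg_left (h1.2.2.2 x) hx.1
    have q2 := mul_le_mul_of_nonneg_left (h2.2.2.2 x) (sub_nonneg.2 hx.2)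
    linarith) hB
  rw [← hId] at step
  have diff : (∫ x, (f (w x) * divN η1 x + (L * w x - f (w x)) * divN η2 x)) -
      ∫ x, (f (moll ρ w x) * divN η1 x + (L * moll ρ w x - f (moll ρ w x)) * divN η2 x) ≤ ε := by
    rw [← integral_sub (gi hw) (gi mi)]
    calc _ ≤ ∫ x, D * |moll ρ w x - w x| := by
          refine integral_mono ((gi hw).sub (gi mi)) ((mi.sub hw).abs.const_mul D) fun x => ?_
          have q1 := hlip (w x) (moll ρ w x)
          rw [abs_sub_comm (w x)] at q1
          have q2 : |divN η1 x| ≤ C1 := hC1 x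
          have q3 : |divN η2 x| ≤ C2 := hC2 x
          set a := w x
          set b := moll ρ w x
          have e : f a * divN η1 x + (L * a - f a) * divN η2 x -
            (f b * divN η1 x + (L * b - f b) * divN η2 x) = (f a - f b) * divN η1 x +
              (L * (a - b) - (f a - f b)) * divN η2 x := by ring
          show f a * divN η1 x + (L * a - f a) * divN η2 x -
            (f b * divN η1 x + (L * b - f b) * divN η2 x) ≤ D * |b - a|
          rw [e]
          have t1 : (f a - f b) * divN η1 x ≤ (L * |b - a|) * C1 := by
            refine (le_abs_self _).trans ?_
            rw [abs_mul]
            exact mul_le_mul q1 q2 (abs_nonneg _) (by positivity)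
          have t3 : |L * (a - b) - (f a - f b)| ≤ 2 * (L * |b - a|) := by
            refine (abs_sub _ _).trans ?_
            rw [abs_mul, abs_of_pos hL, abs_sub_comm a b]
            linarith
          have t2 : (L * (a - b) - (f a - f b)) * divN η2 x ≤ (2 * (L * |b - a|)) * C2 := by
            refine (le_abs_self _).trans ?_
            rw [abs_mul]
            exact mul_le_mul t3 q3 (abs_nonneg _) (by positivity)
          rw [hD]; nlinarith
      _ = D * ∫ x, |moll ρ w x - w x| := by rw [integral_const_mul]
      _ ≤ D * (ε / (D + 1)) := mul_le_mul_of_nonneg_left r7 hD0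
      _ ≤ ε := by
          rw [mul_div_assoc', div_le_iff₀ (by positivity)]
          nlinarith
  linarith

lemma JJ_congr {A : Set (Rn n)} {v w : Rn n → ℝ} (h : ∀ x ∈ A, v x = w x) {η : Rn n → Rn n}
    (hη : tsupport η ⊆ A) : JJ v η = JJ w η := by
  unfold JJ
  congr 1; funext x
  by_cases hx : x ∈ A
  · rw [h x hx]
  · rw [divN_eq_zero fun h' => hx (hη h')]; simp

lemma additivity_on (hφ : IsNormN φ) {A : Set (Rn n)} (hA : IsOpen A) {u : Rn n → ℝ}
    (hu : IntegrableOn u A) {f : ℝ → ℝ} (hf : ContDiff ℝ 2 f) {L : ℝ} (hL : 0 < L)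
    (hd : ∀ t, 0 ≤ deriv f t ∧ deriv f t ≤ L) {B : ℝ} (hB : UB φ A u B)
    {η1 η2 : Rn n → Rn n} (h1 : TestN A φ η1) (h2 : TestN A φ η2) :
    JJ (fun x => f (u x)) η1 + JJ (fun x => L * u x - f (u x)) η2 ≤ L * B := by
  have hw : Integrable (A.indicator u) := (integrable_indicator_iff hA.measurableSet).2 hu
  have e : ∀ x ∈ A, A.indicator u x = u x := fun x hx => indicator_of_mem hx u
  have hB' : UB φ A (A.indicator u) B := fun η hη => by
    rw [JJ_congr e hη.2.2.1]; exact hB η hη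
  have := additivity hφ hA hw hf hL hd hB' h1 h2
  rwa [JJ_congr (w := fun x => f (u x)) (fun x hx => by simp only [e x hx]) h1.2.2.1,
    JJ_congr (w := fun x => L * u x - f (u x)) (fun x hx => by simp only [e x hx]) h2.2.2.1] at this

lemma testN_zero (hφ : IsNormN φ) (A : Set (Rn n)) : TestN A φ (fun _ => 0) :=
  ⟨contDiff_const, HasCompactSupport.zero, by simp, fun x => by simp [hφ.zero]⟩

lemma JJ_zero (v : Rn n → ℝ) : JJ v (fun _ => 0) = 0 := by simp [JJ, divN_zero]

lemma bv_comp (hφ : IsNormN φ) {u : Rn n → ℝ} (hu : BVlocFun Ω u) {f : ℝ → ℝ}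
    (hf : ContDiff ℝ 2 f) {L : ℝ} (hL : 0 < L) (hd : ∀ t, 0 ≤ deriv f t ∧ deriv f t ≤ L) :
    BVlocFun Ω (fun x => f (u x)) ∧ BVlocFun Ω (fun x => L * u x - f (u x)) := by
  have hlip := deriv_lip (hf.differentiable (by norm_num)) hd
  rw [bvloc_iff hφ] at hu
  rw [bvloc_iff hφ, bvloc_iff hφ]
  have l2 := lip_LI hf.continuous hlip hu.1
  refine ⟨⟨l2, fun A hA => ?_⟩, ⟨(hu.1.const_mul L).sub l2, fun A hA => ?_⟩⟩
  · obtain ⟨B, hB⟩ := hu.2 A hA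
    refine ⟨L * B, fun η hη => ?_⟩
    have := additivity_on hφ hA.1 (hu.1 A hA) hf hL hd hB hη (testN_zero hφ A)
    rwa [JJ_zero, add_zero] at this
  · obtain ⟨B, hB⟩ := hu.2 A hA
    refine ⟨L * B, fun η hη => ?_⟩
    have := additivity_on hφ hA.1 (hu.1 A hA) hf hL hd hB (testN_zero hφ A) hη
    rwa [JJ_zero, zero_add] at this

lemma minU_comp (hφ : IsNormN φ) (hΩ : IsOpen Ω) {u : Rn n → ℝ} (hu : BVlocFun Ω u)
    (hmin : MinU φ Ω u) {f : ℝ → ℝ}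
    (hf : ContDiff ℝ 2 f) {L : ℝ} (hL : 0 < L) (hd : ∀ t, 0 ≤ deriv f t ∧ deriv f t ≤ L) :
    MinU φ Ω (fun x => f (u x)) := by
  obtain ⟨-, hh⟩ := bv_comp hφ hu hf hL hd
  intro A hA v hv hc B hB η1 hη1
  have hAΩ : A ⊆ Ω := subset_closure.trans hA.2.2
  have hu0 := (bvloc_iff hφ).1 hu
  have hh0 := (bvloc_iff hφ).1 hh
  have hv0 := (bvloc_iff hφ).1 hv
  set h := fun x => L * u x - f (u x) with hhdef
  have add : ∀ {A : Set (Rn n)} {B B' : ℝ}, A ⊆ Ω → UB φ A v B → UB φ A h B' →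
      UB φ A (fun x => L⁻¹ * (v x + h x)) (L⁻¹ * (B + B')) := by
    intro A B B' hA' h1 h2 η hη
    rw [JJ_const_mul, JJ_add_fun hΩ hv0.1 hh0.1 hη.fld (hη.2.2.1.trans hA')]
    have := h1 η hη
    have := h2 η hη
    gcongr
  have hu' : BVlocFun Ω (fun x => L⁻¹ * (v x + h x)) := by
    rw [bvloc_iff hφ]
    refine ⟨(hv0.1.add hh0.1).const_mul _, fun A hA => ?_⟩
    obtain ⟨B1, hB1⟩ := hv0.2 A hA
    obtain ⟨B2, hB2⟩ := hh0.2 A hA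
    exact ⟨_, add (subset_closure.trans hA.2.2) hB1 hB2⟩
  obtain ⟨B2, hB2⟩ := hh0.2 A hA
  set S : Set ℝ := {r | ∃ η, TestN A φ η ∧ r = JJ h η} with hS
  have hSb : BddAbove S := ⟨B2, by rintro r ⟨η, hη, rfl⟩; exact hB2 η hη⟩
  have hSn : S.Nonempty := ⟨_, _, testN_zero hφ A, rfl⟩
  have hUB : UB φ A h (sSup S) := fun η hη => le_csSup hSb ⟨η, hη, rfl⟩
  have e : (fun x => u x - L⁻¹ * (v x + h x)) = fun x => L⁻¹ * (f (u x) - v x) := by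
    funext x; simp only [hhdef]; field_simp; ring
  have ht : tsupport (fun x => u x - L⁻¹ * (v x + h x)) ⊆ tsupport (fun x => f (u x) - v x) := by
    rw [e]
    exact tsupport_mul_subset_right
  have key := hmin A hA _ hu' ⟨hc.1.of_isClosed_subset (isClosed_tsupport _) ht, ht.trans hc.2⟩ _
    (add hAΩ hB hUB)
  have : sSup S ≤ B + sSup S - JJ (fun x => f (u x)) η1 := by
    refine csSup_le hSn ?_
    rintro r ⟨η2, hη2, rfl⟩
    have := additivity_on hφ hA.1 (hu0.1 A hA) hf hL hd key hη1 hη2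
    rw [mul_inv_cancel_left₀ hL.ne'] at this
    linarith
  linarith

end additivity

open MeasureTheory Set Filter

def Sm (f : ℝ → ℝ) : Prop := ContDiff ℝ 2 f ∧ ∃ L > 0, ∀ t, 0 ≤ deriv f t ∧ deriv f t ≤ L

section steps

lemma Sm.const (c : ℝ) : Sm (fun _ => c) := ⟨contDiff_const, 1, one_pos, fun t => by simp⟩

lemma Sm.add {f g : ℝ → ℝ} (hf : Sm f) (hg : Sm g) : Sm (fun t => f t + g t) := by
  obtain ⟨h1, L, hL, h2⟩ := hf
  obtain ⟨h1', L', hL', h2'⟩ := hg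
  refine ⟨h1.add h1', L + L', by linarith, fun t => ?_⟩
  rw [deriv_fun_add (h1.differentiable (by norm_num) t) (h1'.differentiable (by norm_num) t)]
  have := h2 t
  have := h2' t
  constructor <;> linarith

lemma Sm.mul {f : ℝ → ℝ} (hf : Sm f) {c : ℝ} (hc : 0 ≤ c) : Sm (fun t => c * f t) := by
  obtain ⟨h1, L, hL, h2⟩ := hf
  refine ⟨contDiff_const.mul h1, c * L + 1, by positivity, fun t => ?_⟩
  rw [deriv_const_mul _ (h1.differentiable (by norm_num) t)]
  have := h2 t
  constructor
  · exact mul_nonneg hc this.1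
  · have := mul_le_mul_of_nonneg_left this.2 hc
    linarith

lemma Sm.sum {ι : Type*} (s : Finset ι) {f : ι → ℝ → ℝ} (hf : ∀ i, Sm (f i)) :
    Sm (fun t => ∑ i ∈ s, f i t) := by
  classical
  induction s using Finset.induction_on with
  | empty => simpa using Sm.const 0
  | insert a s ha ih =>
    simp only [Finset.sum_insert ha]
    exact (hf a).add ih

lemma Sm.affine {f : ℝ → ℝ} (hf : Sm f) {c : ℝ} (hc : 0 ≤ c) (d : ℝ) :
    Sm (fun t => f (c * t + d)) := by
  obtain ⟨h1, L, hL, h2⟩ := hf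
  refine ⟨h1.comp ((contDiff_const.mul contDiff_id).add contDiff_const), c * L + 1,
    by positivity, fun t => ?_⟩
  have e : HasDerivAt (fun t => f (c * t + d)) (deriv f (c * t + d) * c) t := by
    have h3 : HasDerivAt (fun t : ℝ => c * t + d) c t := by
      simpa using ((hasDerivAt_id t).const_mul c).add_const d
    exact (h1.differentiable (by norm_num) (c * t + d)).hasDerivAt.comp t h3
  rw [e.deriv]
  have := h2 (c * t + d)
  constructor
  · exact mul_nonneg this.1 hc
  · have := mul_le_mul_of_nonneg_right this.2 hc
    linarith

lemma Sm.smooth : Sm Real.smoothTransition := by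
  have h2 : ContDiff ℝ 2 Real.smoothTransition := Real.smoothTransition.contDiff (n := 2)
  have hc : Continuous (deriv Real.smoothTransition) := h2.continuous_deriv (by norm_num)
  have hs : HasCompactSupport (deriv Real.smoothTransition) := by
    refine HasCompactSupport.intro (K := Icc 0 1) isCompact_Icc fun x hx => ?_
    rw [mem_Icc, not_and_or, not_le, not_le] at hx
    rcases hx with hx | hx
    · have : Real.smoothTransition =ᶠ[nhds x] fun _ => 0 := by
        filter_upwards [Iio_mem_nhds hx] with y hy
        exact Real.smoothTransition.zero_of_nonpos (le_of_lt hy)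
      rw [this.deriv_eq]; simp
    · have : Real.smoothTransition =ᶠ[nhds x] fun _ => 1 := by
        filter_upwards [Ioi_mem_nhds hx] with y hy
        exact Real.smoothTransition.one_of_one_le (le_of_lt hy)
      rw [this.deriv_eq]; simp
  obtain ⟨L, hL⟩ := hs.exists_bound_of_continuous hc
  refine ⟨h2, L + 1, ?_, fun t => ⟨?_, ?_⟩⟩
  · linarith [(norm_nonneg _).trans (hL 0)]
  · exact Real.smoothTransition.monotone.deriv_nonneg
  · linarith [le_abs_self (deriv Real.smoothTransition t), hL t, Real.norm_eq_abs (deriv Real.smoothTransition t)]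

lemma step_approx {U : Set ℝ} (hU : IsUpperSet U) : ∃ S : ℕ → ℝ → ℝ, (∀ m, Sm (S m)) ∧
    (∀ m t, 0 ≤ S m t ∧ S m t ≤ 1) ∧
    ∀ t, Tendsto (fun m => S m t) atTop (nhds (U.indicator (fun _ => 1) t)) := by
  have big : ∀ c : ℝ, 0 < c → ∀ᶠ m : ℕ in atTop, 1 ≤ (m:ℝ) * c := by
    intro c hc
    obtain ⟨N, hN⟩ := exists_nat_gt c⁻¹
    filter_upwards [eventually_ge_atTop N] with m hm
    have : c⁻¹ ≤ m := hN.le.trans (by exact_mod_cast hm)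
    rwa [inv_le_iff_one_le_mul₀ hc] at this
  by_cases h1 : U = ∅
  · refine ⟨fun _ _ => 0, fun _ => Sm.const 0, fun m t => by simp, fun t => by simp [h1]⟩
  by_cases h2 : U = univ
  · refine ⟨fun _ _ => 1, fun _ => Sm.const 1, fun m t => by simp, fun t => by simp [h2]⟩
  rw [← Ne, ← nonempty_iff_ne_empty] at h1
  obtain ⟨b, hb⟩ := (ne_univ_iff_exists_notMem U).1 h2
  have hbl : ∀ t ∈ U, b ≤ t := fun t ht => by
    by_contra h; exact hb (hU (le_of_lt (not_le.1 h)) ht)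
  have hbb : BddBelow U := ⟨b, hbl⟩
  set a := sInf U
  have hgt : ∀ t, a < t → t ∈ U := fun t ht => by
    obtain ⟨s, hs, hst⟩ := exists_lt_of_csInf_lt h1 ht
    exact hU hst.le hs
  have hlt : ∀ t, t < a → t ∉ U := fun t ht h => absurd (csInf_le hbb h) (not_le.2 ht)
  have b01 : ∀ t, 0 ≤ Real.smoothTransition t ∧ Real.smoothTransition t ≤ 1 := fun t =>
    ⟨Real.smoothTransition.nonneg t, Real.smoothTransition.le_one t⟩
  by_cases ha : a ∈ U
  · refine ⟨fun m t => Real.smoothTransition (m * t + (1 - m * a)),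
      fun m => Sm.smooth.affine (Nat.cast_nonneg m) _, fun m t => b01 _, fun t => ?_⟩
    refine tendsto_const_nhds.congr' ?_
    rcases lt_or_ge t a with h | h
    · filter_upwards [big (a - t) (by linarith)] with m hm
      rw [indicator_of_notMem (hlt t h), Real.smoothTransition.zero_of_nonpos]
      linarith
    · filter_upwards with m
      have ht : t ∈ U := hU h ha
      rw [indicator_of_mem ht, Real.smoothTransition.one_of_one_le]
      have : 0 ≤ (m:ℝ) * (t - a) := mul_nonneg (Nat.cast_nonneg m) (by linarith)
      linarith
  · refine ⟨fun m t => Real.smoothTransition (m * t + (- (m * a))),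
      fun m => Sm.smooth.affine (Nat.cast_nonneg m) _, fun m t => b01 _, fun t => ?_⟩
    refine tendsto_const_nhds.congr' ?_
    rcases le_or_gt t a with h | h
    · filter_upwards with m
      have ht : t ∉ U := fun h' => ha (hU h h')
      rw [indicator_of_notMem ht, Real.smoothTransition.zero_of_nonpos]
      have : 0 ≤ (m:ℝ) * (a - t) := mul_nonneg (Nat.cast_nonneg m) (by linarith)
      linarith
    · filter_upwards [big (t - a) (by linarith)] with m hm
      rw [indicator_of_mem (hgt t h), Real.smoothTransition.one_of_one_le]
      linarith

lemma floor_sum {y : ℝ} {N : ℕ} (h : y ≤ N) :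
    ∑ j ∈ Finset.range N, (if ((j:ℝ) + 1 ≤ y) then (1:ℝ) else 0) = ⌊y⌋₊ := by
  rw [← Finset.sum_filter, Finset.sum_const, nsmul_eq_mul, mul_one]
  congr 1
  have : (Finset.range N).filter (fun j : ℕ => (j:ℝ) + 1 ≤ y) = Finset.range ⌊y⌋₊ := by
    ext j
    have hN : ⌊y⌋₊ ≤ N := Nat.floor_le_of_le h
    have : (j:ℝ) + 1 ≤ y ↔ j + 1 ≤ ⌊y⌋₊ := by
      rw [Nat.le_floor_iff' (by omega)]; push_cast; rfl
    simp only [Finset.mem_filter, Finset.mem_range, this]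
    omega
  rw [this, Finset.card_range]

end steps

section limits
variable {n : ℕ} {φ : Rn n → ℝ} {Ω : Set (Rn n)}

lemma LI_lim {g : ℕ → Rn n → ℝ} {g0 : Rn n → ℝ} {M : ℝ} (hb : ∀ m x, |g m x| ≤ M)
    (hg : ∀ m, LI Ω (g m)) (hl : ∀ x, Tendsto (fun m => g m x) atTop (nhds (g0 x))) :
    LI Ω g0 := by
  intro A hA
  refine Integrable.mono' (g := fun _ => M) (integrableOn_const hA.finite.ne) ?_ ?_
  · exact aestronglyMeasurable_of_tendsto_ae atTop (fun m => (hg m A hA).aestronglyMeasurable)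
      (ae_of_all _ hl)
  · exact ae_of_all _ fun x => le_of_tendsto' (hl x).abs fun m => hb m x

lemma QQ_lim (hφ : IsNormN φ) (hΩ : IsOpen Ω) {C : ℝ} {g : ℕ → Rn n → ℝ} {g0 : Rn n → ℝ} {M : ℝ}
    (hb : ∀ m x, |g m x| ≤ M)
    (hg : ∀ m, LI Ω (g m)) (hl : ∀ x, Tendsto (fun m => g m x) atTop (nhds (g0 x)))
    (hQ : ∀ m, QQ φ Ω C (g m)) : QQ φ Ω C g0 := by
  intro ψ h1 h2 h3 h4 v hv B hB η h5 h6
  have hηs : tsupport η ⊆ Ω := (tsupport_sub_of hφ h6).trans h3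
  have hvL : LI Ω v := hv.1
  have hψc : Continuous (fun x => ‖fderiv ℝ ψ x‖) := (h1.continuous_fderiv (by norm_num)).norm
  have hψk : HasCompactSupport (fun x => ‖fderiv ℝ ψ x‖) := (h2.fderiv ℝ).norm
  have hψs : tsupport (fun x => ‖fderiv ℝ ψ x‖) ⊆ Ω := by
    refine Subset.trans (closure_mono ?_) ((tsupport_fderiv_subset ℝ (f := ψ)).trans h3)
    intro x hx
    simpa using hx
  have labs : ∀ {k : Rn n → ℝ}, LI Ω k → LI Ω (fun x => |k x|) := fun hk A hA => (hk A hA).abs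
  have lconst : ∀ c : ℝ, LI Ω (fun _ => c) := fun c A hA => integrableOn_const hA.finite.ne
  have t1 : Tendsto (fun m => JJ (g m) η) atTop (nhds (JJ g0 η)) := by
    unfold JJ
    refine tendsto_integral_of_dominated_convergence (fun x => M * |divN η x|) ?_ ?_ ?_ ?_
    · exact fun m => ((hg m).integrable_div hΩ h5 hηs).aestronglyMeasurable
    · exact (((divN_continuous h5.1).integrable_of_hasCompactSupport h5.divN_compact).abs).const_mul M
    · refine fun m => ae_of_all _ fun x => ?_
      rw [Real.norm_eq_abs, abs_mul]
      exact mul_le_mul_of_nonneg_right (hb m x) (abs_nonneg _)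
    · exact ae_of_all _ fun x => (hl x).mul_const _
  have t2 : Tendsto (fun m => ∫ x, |g m x - v x| * ‖fderiv ℝ ψ x‖) atTop
      (nhds (∫ x, |g0 x - v x| * ‖fderiv ℝ ψ x‖)) := by
    refine tendsto_integral_of_dominated_convergence
      (fun x => (M + |v x|) * ‖fderiv ℝ ψ x‖) ?_ ?_ ?_ ?_
    · exact fun m => ((labs ((hg m).sub hvL)).integrable_mul hΩ hψc hψk hψs).aestronglyMeasurable
    · exact ((lconst M).add (labs hvL)).integrable_mul hΩ hψc hψk hψs
    · refine fun m => ae_of_all _ fun x => ?_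
      rw [Real.norm_eq_abs, abs_mul, abs_abs, abs_norm]
      refine mul_le_mul_of_nonneg_right ?_ (norm_nonneg _)
      exact (abs_sub _ _).trans (by linarith [hb m x])
    · exact ae_of_all _ fun x => ((hl x).sub_const _).abs.mul_const _
  exact le_of_tendsto_of_tendsto' t1 ((t2.const_mul C).const_add B)
    fun m => hQ m ψ h1 h2 h3 h4 v hv B hB η h5 h6

lemma QQ_bdd_mono (hφ : IsNormN φ) (hΩ : IsOpen Ω) {C : ℝ} (hl : ∀ x, ‖x‖ ≤ C * φ x) (hC : 0 < C)
    {u : Rn n → ℝ} (hu : BVlocFun Ω u) (hmin : MinU φ Ω u) {f : ℝ → ℝ} (hf : Monotone f) {M : ℝ}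
    (hM : ∀ t, |f t| ≤ M) : LI Ω (fun x => f (u x)) ∧ QQ φ Ω C (fun x => f (u x)) := by
  have sm : ∀ {s : ℝ → ℝ}, Sm s → LI Ω (fun x => s (u x)) ∧ QQ φ Ω C (fun x => s (u x)) := by
    rintro s ⟨h1, L, hL, h2⟩
    have hb := (bv_comp hφ hu h1 hL h2).1
    exact ⟨hb.1, (minU_comp hφ hΩ hu hmin h1 hL h2).toQQ hφ hΩ hl hC hb⟩
  have hM0 : 0 ≤ M := (abs_nonneg _).trans (hM 0)
  have hup : ∀ c : ℝ, IsUpperSet {t | c ≤ f t} := fun c a b hab h => le_trans h (hf hab)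
  -- step functions
  have st : ∀ (k : ℝ) (N : ℕ) (c : ℕ → ℝ), 0 ≤ k →
      LI Ω (fun x => -M + k * ∑ j ∈ Finset.range N, {t | c j ≤ f t}.indicator (fun _ => (1:ℝ)) (u x)) ∧
      QQ φ Ω C (fun x => -M + k * ∑ j ∈ Finset.range N,
        {t | c j ≤ f t}.indicator (fun _ => (1:ℝ)) (u x)) := by
    intro k N c hk
    choose S s1 s2 s3 using fun j => step_approx (hup (c j))
    have hsm : ∀ m, Sm (fun t => -M + k * ∑ j ∈ Finset.range N, S j m t) := fun m =>
      (Sm.const _).add ((Sm.sum _ fun j => s1 j m).mul hk)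
    have hbd : ∀ m x, |-M + k * ∑ j ∈ Finset.range N, S j m (u x)| ≤ M + k * N := by
      intro m x
      have q1 : 0 ≤ ∑ j ∈ Finset.range N, S j m (u x) := Finset.sum_nonneg fun j _ => (s2 j m _).1
      have q2 : ∑ j ∈ Finset.range N, S j m (u x) ≤ N := by
        refine (Finset.sum_le_sum fun j _ => (s2 j m (u x)).2).trans ?_
        simp
      have q3 := mul_nonneg hk q1
      have q4 := mul_le_mul_of_nonneg_left q2 hk
      rw [abs_le]; constructor <;> linarith
    have hlim : ∀ x, Tendsto (fun m => -M + k * ∑ j ∈ Finset.range N, S j m (u x)) atTop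
        (nhds (-M + k * ∑ j ∈ Finset.range N, {t | c j ≤ f t}.indicator (fun _ => (1:ℝ)) (u x))) :=
      fun x => ((tendsto_finsetSum _ fun j _ => s3 j (u x)).const_mul k).const_add _
    exact ⟨LI_lim hbd (fun m => (sm (hsm m)).1) hlim,
      QQ_lim hφ hΩ hbd (fun m => (sm (hsm m)).1) hlim (fun m => (sm (hsm m)).2)⟩
  let N : ℕ → ℕ := fun k => ⌈((k:ℝ) + 1) * (2 * M)⌉₊
  let F : ℕ → Rn n → ℝ := fun k x => -M + (1 / ((k:ℝ) + 1)) * ∑ j ∈ Finset.range (N k),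
    {t | ((j:ℝ) + 1) / (k + 1) - M ≤ f t}.indicator (fun _ => (1:ℝ)) (u x)
  have hF := fun k : ℕ => st (1 / ((k:ℝ) + 1)) (N k) (fun j => ((j:ℝ) + 1) / (k + 1) - M)
    (by positivity)
  have eF : ∀ k x, F k x = -M + (1 / ((k:ℝ) + 1)) * ⌊((k:ℝ) + 1) * (f (u x) + M)⌋₊ := by
    intro k x
    have hy : ((k:ℝ) + 1) * (f (u x) + M) ≤ N k := by
      refine le_trans ?_ (Nat.le_ceil _)
      have := (abs_le.1 (hM (u x))).2
      gcongr; linarith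
    simp only [F]
    rw [← floor_sum hy]
    congr 2
    refine Finset.sum_congr rfl fun j _ => ?_
    rw [indicator_apply]
    refine if_congr ?_ rfl rfl
    simp only [mem_ofPred_eq]
    rw [sub_le_iff_le_add, div_le_iff₀ (by positivity), mul_comm]
  have est : ∀ (k : ℕ) (x : Rn n), f (u x) - 1 / ((k:ℝ) + 1) ≤ F k x ∧ F k x ≤ f (u x) ∧ -M ≤ F k x := by
    intro k x
    rw [eF]
    have hk : (0:ℝ) < k + 1 := by positivity
    have h0 : 0 ≤ ((k:ℝ) + 1) * (f (u x) + M) :=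
      mul_nonneg hk.le (by linarith [(abs_le.1 (hM (u x))).1])
    have q1 := Nat.floor_le h0
    have q2 := Nat.lt_floor_add_one (((k:ℝ) + 1) * (f (u x) + M))
    set y : ℝ := (⌊((k:ℝ) + 1) * (f (u x) + M)⌋₊ : ℝ)
    have e1 : 1 / ((k:ℝ) + 1) * (((k:ℝ) + 1) * (f (u x) + M)) = f (u x) + M := by field_simp
    have hk' : 0 ≤ 1 / ((k:ℝ) + 1) := by positivity
    have q3 := mul_le_mul_of_nonneg_left q1 hk'
    have q4 := mul_le_mul_of_nonneg_left q2.le hk'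
    rw [e1] at q3 q4
    have q5 : 0 ≤ 1 / ((k:ℝ) + 1) * y := mul_nonneg hk' (Nat.cast_nonneg _)
    refine ⟨by linarith, by linarith, by linarith⟩
  have hbd : ∀ k x, |F k x| ≤ M := fun k x =>
    abs_le.2 ⟨(est k x).2.2, (est k x).2.1.trans (abs_le.1 (hM _)).2⟩
  have hlim : ∀ x, Tendsto (fun k => F k x) atTop (nhds (f (u x))) := by
    intro x
    refine tendsto_of_tendsto_of_tendsto_of_le_of_le (g := fun k : ℕ => f (u x) - 1 / ((k:ℝ) + 1))
      (h := fun _ => f (u x)) ?_ tendsto_const_nhds (fun k => (est k x).1) (fun k => (est k x).2.1)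
    simpa using (tendsto_one_div_add_atTop_nhds_zero_nat (𝕜 := ℝ)).const_sub (f (u x))
  exact ⟨LI_lim hbd (fun k => (hF k).1) hlim,
    QQ_lim hφ hΩ hbd (fun k => (hF k).1) hlim (fun k => (hF k).2)⟩

end limits

open MeasureTheory Set Filter

section iso
variable {n : ℕ}

lemma divN_const_dir {θ : Rn n → ℝ} (hθ : Differentiable ℝ θ) (h x : Rn n) :
    divN (fun y => θ y • h) x = fderiv ℝ θ x h := by
  rw [divN_smul hθ (differentiable_const h)]
  have : divN (fun _ : Rn n => h) x = 0 := by simp [divN]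
  rw [this]; simp

lemma iso_smooth {w θ : Rn n → ℝ} (hw : Integrable w) {P : ℝ}
    (hP : ∀ η, Fld η → (∀ x, ‖η x‖ ≤ 1) → JJ w η ≤ P) (hθ : ContDiff ℝ 1 θ)
    (hc : HasCompactSupport θ) (h1 : ∀ x, |θ x| ≤ 1) (h : Rn n) :
    (∫ x, w x * θ x) - ∫ x, w x * θ (x - h) ≤ ‖h‖ * P := by
  by_cases hh : h = 0
  · simp [hh]
  have hn : 0 < ‖h‖ := norm_pos_iff.2 hh
  have hd : Differentiable ℝ θ := hθ.differentiable (by norm_num)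
  have hcf : Continuous (fderiv ℝ θ) := hθ.continuous_fderiv (by norm_num)
  obtain ⟨D, hD⟩ := (hc.fderiv ℝ).exists_bound_of_continuous hcf
  have hder : ∀ s : ℝ, HasDerivAt (fun s : ℝ => ∫ x, w x * θ (x - s • h))
      (∫ x, w x * (- fderiv ℝ θ (x - s • h) h)) s := by
    intro s
    refine (hasDerivAt_integral_of_dominated_loc_of_deriv_le (s := univ)
      (F := fun (s : ℝ) (x : Rn n) => w x * θ (x - s • h))
      (F' := fun (s : ℝ) (x : Rn n) => w x * (- fderiv ℝ θ (x - s • h) h))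
      (bound := fun x => |w x| * (D * ‖h‖)) univ_mem ?_ ?_ ?_ ?_ ?_ ?_).2
    · refine Eventually.of_forall fun s => ?_
      exact hw.aestronglyMeasurable.mul
        (hθ.continuous.comp (continuous_id.sub continuous_const)).aestronglyMeasurable
    · exact hw.mul_bdd (c := 1)
        (hθ.continuous.comp (continuous_id.sub continuous_const)).aestronglyMeasurable
        (ae_of_all _ fun x => h1 _)
    · refine hw.aestronglyMeasurable.mul (Continuous.aestronglyMeasurable ?_)
      exact ((hcf.comp (continuous_id.sub continuous_const)).clm_apply continuous_const).neg
    · refine ae_of_all _ fun x s _ => ?_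
      rw [norm_mul, norm_neg, Real.norm_eq_abs]
      refine mul_le_mul_of_nonneg_left ?_ (abs_nonneg _)
      exact (ContinuousLinearMap.le_opNorm _ _).trans
        (mul_le_mul_of_nonneg_right (hD _) (norm_nonneg _))
    · exact hw.abs.mul_const _
    · refine ae_of_all _ fun x s _ => ?_
      have e1 : HasDerivAt (fun s : ℝ => x - s • h) (-h) s := by
        simpa using ((hasDerivAt_id s).smul_const h).const_sub x
      have e2 := (hd (x - s • h)).hasFDerivAt.comp_hasDerivAt s e1
      have e3 := e2.const_mul (w x)
      simpa using e3
  have hge : ∀ s : ℝ, -(‖h‖ * P) ≤ ∫ x, w x * (- fderiv ℝ θ (x - s • h) h) := by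
    intro s
    have hθs : ContDiff ℝ 1 (fun x => θ (x - s • h)) := hθ.comp (contDiff_id.sub contDiff_const)
    have hcs : HasCompactSupport (fun x => θ (x - s • h)) :=
      hc.comp_homeomorph (Homeomorph.subRight (s • h))
    have hF : Fld (fun x => θ (x - s • h) • (‖h‖⁻¹ • h)) :=
      by
      refine ⟨hθs.smul contDiff_const, ?_⟩
      exact HasCompactSupport.smul_right (f := fun x => θ (x - s • h))
        (f' := fun _ => ‖h‖⁻¹ • h) hcs
    have := hP _ hF (fun x => by
      rw [norm_smul, norm_smul, norm_inv, norm_norm, inv_mul_cancel₀ hn.ne', mul_one]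
      exact h1 _)
    have e : JJ w (fun x => θ (x - s • h) • (‖h‖⁻¹ • h)) =
        ‖h‖⁻¹ * ∫ x, w x * (fderiv ℝ θ (x - s • h) h) := by
      unfold JJ
      rw [← integral_const_mul]
      congr 1; funext x
      rw [divN_const_dir (hθs.differentiable (by norm_num)), fderiv_comp_sub]
      simp; ring
    rw [e, inv_mul_le_iff₀ hn] at this
    simp only [mul_neg, integral_neg]
    linarith
  have := mul_sub_le_image_sub_of_le_deriv (fun s => (hder s).differentiableAt)
    (fun s => by rw [(hder s).deriv]; exact hge s) (zero_le_one' ℝ)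
  simp only [one_smul, zero_smul, sub_zero, mul_one] at this
  linarith

lemma moll_bdd {w ρ : Rn n → ℝ} (hρ : Integrable ρ) (h0 : ∀ h, 0 ≤ ρ h) (h1 : ∫ h, ρ h = 1)
    (hw : ∀ x, |w x| ≤ 1) (x : Rn n) : |moll ρ w x| ≤ 1 := by
  rw [← h1, ← Real.norm_eq_abs]
  refine norm_integral_le_of_norm_le hρ (ae_of_all _ fun h => ?_)
  rw [Real.norm_eq_abs, abs_mul, abs_of_nonneg (h0 h)]
  exact mul_le_of_le_one_right (h0 h) (hw _)

lemma moll_compact {w ρ : Rn n → ℝ} {δ : ℝ} (hs : ∀ h, δ ≤ ‖h‖ → ρ h = 0)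
    (hw : HasCompactSupport w) : HasCompactSupport (moll ρ w) := by
  obtain ⟨R, hR⟩ := hw.isCompact.isBounded.subset_closedBall 0
  refine HasCompactSupport.intro (isCompact_closedBall (0 : Rn n) (R + δ)) fun x hx => ?_
  unfold moll
  rw [integral_eq_zero_of_ae]
  refine ae_of_all _ fun h => ?_
  by_cases hh : δ ≤ ‖h‖
  · simp [hs h hh]
  · have : w (x - h) = 0 := by
      by_contra hne
      have := hR (subset_tsupport _ hne)
      rw [mem_closedBall_zero_iff] at this hx
      have := norm_sub_norm_le x h
      linarith [not_le.1 hh]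
    simp [this]

lemma iso_transl {w : Rn n → ℝ} (hw : Integrable w) (hc : HasCompactSupport w)
    (h1 : ∀ x, |w x| ≤ 1) {P : ℝ}
    (hP : ∀ η, Fld η → (∀ x, ‖η x‖ ≤ 1) → JJ w η ≤ P) (h : Rn n) :
    (∫ x, w x * w x) - ∫ x, w x * w (x - h) ≤ ‖h‖ * P := by
  refine le_of_forall_pos_le_add fun ε hε => ?_
  obtain ⟨ρ, r1, r2, r3, r4, r5, r6, r7⟩ := moll_exists hw (half_pos hε) one_pos
  have mi := moll_integrable hw r2
  have mb := moll_bdd r2 r3 r4 h1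
  have key := iso_smooth hw hP (r6.of_le (by norm_num)) (moll_compact r5 hc) mb h
  set θ := moll ρ w
  have bi : ∀ {g : Rn n → ℝ}, Integrable g → Integrable (fun x => w x * g x) := fun hg =>
    hg.bdd_mul (c := 1) hw.aestronglyMeasurable (ae_of_all _ h1)
  have cmp : ∀ {g k : Rn n → ℝ}, Integrable g → Integrable k →
      (∫ x, w x * g x) - ∫ x, w x * k x ≤ ∫ x, |k x - g x| := by
    intro g k hg hk
    rw [← integral_sub (bi hg) (bi hk)]
    refine integral_mono ((bi hg).sub (bi hk)) (hk.sub hg).abs fun x => ?_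
    show w x * g x - w x * k x ≤ |k x - g x|
    rw [← mul_sub, abs_sub_comm]
    refine (le_abs_self _).trans ?_
    rw [abs_mul]
    exact mul_le_of_le_one_left (abs_nonneg _) (h1 x)
  have c1 := cmp hw mi
  have c2 := cmp (mi.comp_sub_right h) (hw.comp_sub_right h)
  have e : ∫ x, |w (x - h) - θ (x - h)| = ∫ x, |θ x - w x| := by
    rw [integral_sub_right_eq_self (fun x => |w x - θ x|) h]
    congr 1; funext x; rw [abs_sub_comm]
  rw [e] at c2
  linarith

lemma iso_avg {w : Rn n → ℝ} (hw : Integrable w) (hc : HasCompactSupport w)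
    (h1 : ∀ x, 0 ≤ w x ∧ w x ≤ 1) {P : ℝ}
    (hP : ∀ η, Fld η → (∀ x, ‖η x‖ ≤ 1) → JJ w η ≤ P) {s : ℝ} (hs : 0 < s) :
    volume.real (Metric.ball (0 : Rn n) s) * ∫ x, w x * w x ≤
      volume.real (Metric.ball (0 : Rn n) s) * (s * P) + (∫ x, w x) ^ 2 := by
  have habs : ∀ x, |w x| ≤ 1 := fun x => abs_le.2 ⟨by linarith [(h1 x).1], (h1 x).2⟩
  have hP0 : 0 ≤ P := by
    have := hP _ fld_zero (fun x => by simp)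
    rwa [JJ_zero] at this
  have hw' : Integrable (fun x => w (-x)) := hw.comp_neg
  have eG : (fun h => ∫ x, w x * w (x - h)) = moll w (fun x => w (-x)) := by
    funext h; simp [moll]
  have hG : Integrable (fun h => ∫ x, w x * w (x - h)) := by
    rw [eG]; exact moll_integrable hw' hw
  have hGi : ∫ h, ∫ x, w x * w (x - h) = (∫ x, w x) ^ 2 := by
    have := integral_integral_swap (f := fun y h => w h * w (-(y - h))) (conv_int hw' hw)
    simp only [neg_sub] at this
    rw [this]
    simp only [integral_const_mul]
    have e : ∀ h : Rn n, ∫ x, w (h - x) = ∫ x, w x := fun h => integral_sub_left_eq_self w volume h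
    simp only [e, integral_mul_const]
    ring
  set a := ∫ x, w x * w x
  set Bs := Metric.ball (0 : Rn n) s
  have hfin : volume Bs ≠ ⊤ := measure_ball_lt_top.ne
  have c1 : ∫ h in Bs, (a - s * P) ≤ ∫ h in Bs, ∫ x, w x * w (x - h) := by
    refine setIntegral_mono_on (integrableOn_const hfin) hG.integrableOn measurableSet_ball ?_
    intro h hh
    have := iso_transl hw hc habs hP h
    have h2 : ‖h‖ * P ≤ s * P :=
      mul_le_mul_of_nonneg_right (le_of_lt (by simpa [Bs] using hh)) hP0
    linarith
  have c2 : ∫ h in Bs, ∫ x, w x * w (x - h) ≤ ∫ h, ∫ x, w x * w (x - h) :=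
    setIntegral_le_integral hG (ae_of_all _ fun h => integral_nonneg fun x =>
      mul_nonneg (h1 _).1 (h1 _).1)
  rw [setIntegral_const, smul_eq_mul] at c1
  rw [hGi] at c2
  nlinarith

end iso

open MeasureTheory Set Filter

section cutoff
variable {n : ℕ}

lemma cutoff_ball : ∃ D > 0, ∀ (n : ℕ) (x0 : Rn n) (ρ' ρ : ℝ), 0 < ρ' → ρ' < ρ →
    ∃ χ : Rn n → ℝ, ContDiff ℝ 1 χ ∧ HasCompactSupport χ ∧ tsupport χ ⊆ Metric.closedBall x0 ρ ∧
      (∀ x, 0 ≤ χ x ∧ χ x ≤ 1) ∧ (∀ x ∈ Metric.closedBall x0 ρ', χ x = 1) ∧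
      ∀ x, ‖fderiv ℝ χ x‖ ≤ D / (ρ - ρ') := by
  obtain ⟨hs, L, hL, hd⟩ := Sm.smooth
  refine ⟨2 * L, by positivity, fun n x0 ρ' ρ h0 h1 => ?_⟩
  have hden : 0 < ρ ^ 2 - ρ' ^ 2 := by nlinarith
  let q : Rn n → ℝ := fun x => (ρ ^ 2 - ‖x - x0‖ ^ 2) / (ρ ^ 2 - ρ' ^ 2)
  have hq : ContDiff ℝ 1 q :=
    (contDiff_const.sub ((contDiff_id.sub contDiff_const).norm_sq ℝ)).div_const _
  let χ : Rn n → ℝ := fun x => Real.smoothTransition (q x)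
  have hχ : ContDiff ℝ 1 χ := (hs.of_le (by norm_num)).comp hq
  have h00 : ∀ x, x ∉ Metric.ball x0 ρ → χ x = 0 := by
    intro x hx
    have : ρ ≤ ‖x - x0‖ := by simpa [dist_eq_norm] using hx
    refine Real.smoothTransition.zero_of_nonpos (div_nonpos_of_nonpos_of_nonneg ?_ hden.le)
    nlinarith
  have hts : tsupport χ ⊆ Metric.closedBall x0 ρ := by
    refine closure_minimal (fun x hx => ?_) Metric.isClosed_closedBall
    by_contra h
    exact hx (h00 x fun h' => h (Metric.ball_subset_closedBall h'))
  refine ⟨χ, hχ, (isCompact_closedBall x0 ρ).of_isClosed_subset (isClosed_tsupport _) hts, hts,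
    fun x => ⟨Real.smoothTransition.nonneg _, Real.smoothTransition.le_one _⟩, fun x hx => ?_,
    fun x => ?_⟩
  · have : ‖x - x0‖ ≤ ρ' := by simpa [dist_eq_norm] using hx
    refine Real.smoothTransition.one_of_one_le ?_
    rw [le_div_iff₀ hden]
    nlinarith [norm_nonneg (x - x0)]
  · by_cases hx : x ∈ tsupport χ
    · have hx' : ‖x - x0‖ ≤ ρ := by simpa [dist_eq_norm] using hts hx
      obtain ⟨T, hT⟩ : ∃ T : Rn n →L[ℝ] ℝ, T = innerSL ℝ (x - x0) := ⟨_, rfl⟩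
      have hTn : ‖T‖ = ‖x - x0‖ := by rw [hT, innerSL_apply_norm]
      have d1 : HasFDerivAt (fun x : Rn n => ‖x - x0‖ ^ 2) ((2:ℝ) • T) x := by
        have := (hasStrictFDerivAt_norm_sq (x - x0)).hasFDerivAt.comp x
          ((hasFDerivAt_id x).sub_const x0)
        refine this.congr_fderiv ?_
        rw [hT]
        ext y
        simp [two_smul, two_mul]
      have d2 : HasFDerivAt q ((ρ ^ 2 - ρ' ^ 2)⁻¹ • (-((2:ℝ) • T))) x := by
        have := (d1.const_sub (ρ ^ 2)).const_mul (ρ ^ 2 - ρ' ^ 2)⁻¹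
        refine this.congr_of_eventuallyEq (Eventually.of_forall fun y => ?_)
        simp only [q]; rw [div_eq_inv_mul]
      have d3 : HasFDerivAt χ (deriv Real.smoothTransition (q x) •
          ((ρ ^ 2 - ρ' ^ 2)⁻¹ • (-((2:ℝ) • T)))) x :=
        (hs.differentiable (by norm_num) (q x)).hasDerivAt.comp_hasFDerivAt x d2
      rw [d3.fderiv, norm_smul, norm_smul, norm_neg, norm_smul, hTn]
      have hn2 : ‖(2:ℝ)‖ = 2 := by simp
      rw [hn2, Real.norm_eq_abs, Real.norm_eq_abs, abs_of_nonneg (hd _).1,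
        abs_of_pos (inv_pos.2 hden)]
      have e2 : (ρ ^ 2 - ρ' ^ 2)⁻¹ * (2 * ‖x - x0‖) ≤ 2 / (ρ - ρ') := by
        rw [inv_mul_le_iff₀ hden, mul_div_assoc', le_div_iff₀ (by linarith)]
        have : ‖x - x0‖ * (ρ - ρ') ≤ ρ * (ρ - ρ') :=
          mul_le_mul_of_nonneg_right hx' (by linarith)
        nlinarith
      calc _ ≤ L * (2 / (ρ - ρ')) :=
            mul_le_mul (hd _).2 e2 (mul_nonneg (inv_pos.2 hden).le (by positivity)) hL.le
        _ = _ := by ring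
    · have : fderiv ℝ χ x = 0 := by
        by_contra h
        exact hx (support_fderiv_subset ℝ (by simpa using h))
      rw [this, norm_zero]
      have : 0 < ρ - ρ' := by linarith
      positivity

lemma iteration {m : ℕ → ℝ} {K V r μ s0 Λ : ℝ} {N : ℕ} (hK : 0 < K) (hV : 0 < V) (hr : 0 < r)
    (hΛ : Λ = (1 / 4) ^ (N + 1)) (hs0 : s0 = Λ * r / (4 * K)) (hμ : μ = Λ * s0 ^ N * V / 2)
    (h0 : ∀ k, 0 ≤ m k)
    (hm : ∀ k, ∀ s > 0, m (k + 1) ≤ s * (K / (r * (1 / 2) ^ (k + 1))) * m k + m k ^ 2 / (s ^ N * V))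
    (hi : m 0 ≤ μ) (k : ℕ) : m k ≤ μ * Λ ^ k := by
  have hΛ0 : 0 < Λ := by rw [hΛ]; positivity
  have hs00 : 0 < s0 := by rw [hs0]; positivity
  have hμ0 : 0 < μ := by rw [hμ]; positivity
  induction k with
  | zero => simpa using hi
  | succ k ih =>
    have hsk : 0 < s0 * (1 / 4) ^ k := by positivity
    refine (hm k _ hsk).trans ?_
    have a1 : s0 * (1 / 4) ^ k * (K / (r * (1 / 2) ^ (k + 1))) * m k ≤ Λ / 2 * (μ * Λ ^ k) := by
      refine mul_le_mul ?_ ih (h0 k) (by positivity)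
      have e : s0 * (1 / 4) ^ k * (K / (r * (1 / 2) ^ (k + 1))) = Λ / 2 * (1 / 2) ^ k := by
        rw [hs0]
        have : ((1:ℝ) / 4) ^ k = (1 / 2) ^ k * (1 / 2) ^ k := by rw [← mul_pow]; norm_num
        rw [this, pow_succ]
        field_simp
        ring
      rw [e]
      exact mul_le_of_le_one_right (by positivity) (pow_le_one₀ (by norm_num) (by norm_num))
    have a2 : m k ^ 2 / ((s0 * (1 / 4) ^ k) ^ N * V) ≤ Λ / 2 * (μ * Λ ^ k) := by
      rw [div_le_iff₀ (by positivity)]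
      have e1 : m k ^ 2 ≤ (μ * Λ ^ k) ^ 2 := pow_le_pow_left₀ (h0 k) ih 2
      refine e1.trans ?_
      have e2 : Λ ^ k ≤ ((1 / 4) ^ k) ^ N := by
        rw [hΛ, ← pow_mul, ← pow_mul]
        refine pow_le_pow_of_le_one (by norm_num) (by norm_num) ?_
        nlinarith
      have e3 : Λ / 2 * (μ * Λ ^ k) * ((s0 * (1 / 4) ^ k) ^ N * V) =
          (μ * Λ ^ k) * (μ * ((1 / 4) ^ k) ^ N) := by
        have hμ2 : Λ * s0 ^ N * V = 2 * μ := by rw [hμ]; ring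
        rw [mul_pow]
        calc _ = (Λ * s0 ^ N * V) / 2 * (μ * Λ ^ k) * ((1 / 4) ^ k) ^ N := by ring
          _ = _ := by rw [hμ2]; ring
      rw [e3, sq]
      refine mul_le_mul_of_nonneg_left (mul_le_mul_of_nonneg_left e2 hμ0.le) (by positivity)
    calc _ ≤ Λ / 2 * (μ * Λ ^ k) + Λ / 2 * (μ * Λ ^ k) := add_le_add a1 a2
      _ = μ * Λ ^ (k + 1) := by ring

end cutoff

open MeasureTheory Set Filter

section degiorgi
variable {n : ℕ}

lemma ball_vol {s : ℝ} (hs : 0 < s) :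
    volume.real (Metric.ball (0 : Rn n) s) = s ^ n * volume.real (Metric.ball (0 : Rn n) 1) := by
  rw [measureReal_def, Measure.addHaar_ball_of_pos _ _ hs, ENNReal.toReal_mul,
    ENNReal.toReal_ofReal (by positivity), measureReal_def]
  simp

lemma LI.cball {Ω : Set (Rn n)} (hΩ : IsOpen Ω) {g : Rn n → ℝ} (hg : LI Ω g) {x0 : Rn n} {ρ : ℝ}
    (hb : Metric.closedBall x0 ρ ⊆ Ω) : IntegrableOn g (Metric.closedBall x0 ρ) := by
  obtain ⟨A, hA, hKA⟩ := exists_cp (isCompact_closedBall x0 ρ) hΩ hb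
  exact (hg A hA).mono_set hKA

lemma dg_step {φ : Rn n → ℝ} {Ω : Set (Rn n)} (hφ : IsNormN φ) (hΩ : IsOpen Ω) {C Cu : ℝ}
    (hCu : 0 < Cu) (hup : ∀ x, φ x ≤ Cu * ‖x‖) (hC : 0 < C) {g : Rn n → ℝ} (hg : LI Ω g)
    (hQ : QQ φ Ω C g) (h01 : ∀ x, 0 ≤ g x ∧ g x ≤ 1) (h11 : ∀ x, g x * g x = g x)
    {x0 : Rn n} {ρ' ρ : ℝ}
    (hρ : ρ' < ρ) (hb : Metric.closedBall x0 ρ ⊆ Ω) {E : ℝ} {χ : Rn n → ℝ}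
    (hχ : ContDiff ℝ 1 χ) (hχc : HasCompactSupport χ) (hχs : tsupport χ ⊆ Metric.closedBall x0 ρ)
    (hχ1 : ∀ x, 0 ≤ χ x ∧ χ x ≤ 1) (hχ2 : ∀ x ∈ Metric.closedBall x0 ρ', χ x = 1)
    (hE : ∀ x, ‖fderiv ℝ χ x‖ ≤ E) {s : ℝ} (hs : 0 < s) :
    ∫ x in Metric.closedBall x0 ρ', g x ≤
      s * ((Cu * C + 1) * E) * (∫ x in Metric.closedBall x0 ρ, g x) +
       (∫ x in Metric.closedBall x0 ρ, g x) ^ 2 /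
        (s ^ n * volume.real (Metric.ball (0 : Rn n) 1)) := by
  set m := ∫ x in Metric.closedBall x0 ρ, g x with hm
  have hχΩ := hχs.trans hb
  have hgi : IntegrableOn g (Metric.closedBall x0 ρ) := hg.cball hΩ hb
  have hmi : MeasurableSet (Metric.closedBall x0 ρ) := measurableSet_closedBall
  have hmi' : MeasurableSet (Metric.closedBall x0 ρ') := measurableSet_closedBall
  have hgI : Integrable ((Metric.closedBall x0 ρ).indicator g) := hgi.integrable_indicator hmi
  have hmI : m = ∫ x, (Metric.closedBall x0 ρ).indicator g x := (integral_indicator hmi).symm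
  have hχz : ∀ x, x ∉ Metric.closedBall x0 ρ → χ x = 0 := fun x hx =>
    image_eq_zero_of_notMem_tsupport fun h => hx (hχs h)
  have hdz : ∀ x, x ∉ Metric.closedBall x0 ρ → fderiv ℝ χ x = 0 := fun x hx => by
    by_contra h
    exact hx (hχs (support_fderiv_subset ℝ (by simpa using h)))
  have hdc : Continuous (fderiv ℝ χ) := hχ.continuous_fderiv (by norm_num)
  have hfc : HasCompactSupport (fun x => ‖fderiv ℝ χ x‖) := (hχc.fderiv ℝ).norm
  -- gradient term
  have hgn : Integrable (fun x => g x * ‖fderiv ℝ χ x‖) := by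
    refine hg.integrable_mul hΩ hdc.norm hfc ?_
    refine (closure_mono ?_).trans ((tsupport_fderiv_subset ℝ).trans hχΩ)
    intro x hx; simpa using hx
  have hgrad : ∫ x, g x * ‖fderiv ℝ χ x‖ ≤ E * m := by
    rw [hmI, ← integral_const_mul]
    refine integral_mono hgn (hgI.const_mul _) fun x => ?_
    by_cases hx : x ∈ Metric.closedBall x0 ρ
    · simp only [indicator_of_mem hx]
      rw [mul_comm]
      exact mul_le_mul_of_nonneg_right (hE x) (h01 x).1
    · simp [indicator_of_notMem hx, hdz x hx]
  have hz : BVlocFun Ω (fun _ : Rn n => (0:ℝ)) := by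
    rw [bvloc_iff hφ]
    exact ⟨fun A hA => integrableOn_zero, fun A hA => ⟨0, fun η hη => by simp [JJ]⟩⟩
  have hwi : Integrable (fun x => g x * χ x) := hg.integrable_mul hΩ hχ.continuous hχc hχΩ
  have hP : ∀ η, Fld η → (∀ x, ‖η x‖ ≤ 1) →
      JJ (fun x => g x * χ x) η ≤ (Cu * C + 1) * (E * m) := by
    intro η hη hη1
    have hF : Fld (fun x => χ x • η x) := hη.smul hχ
    have hFs : tsupport (fun x => χ x • η x) ⊆ tsupport χ := by
      refine closure_mono fun x hx => ?_
      intro h; exact hx (by simp only [h, zero_smul])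
    have hF' : Fld (fun x => Cu⁻¹ • (χ x • η x)) := hF.const_smul _
    have hq := hQ χ hχ hχc hχΩ hχ1 _ hz 0 (fun η _ _ => by simp [JJ]) _ hF' (fun x => by
      rw [hφ.smul (inv_pos.2 hCu).le, hφ.smul (hχ1 x).1, inv_mul_le_iff₀ hCu, mul_comm Cu]
      refine mul_le_mul_of_nonneg_left ((hup _).trans ?_) (hχ1 x).1
      exact mul_le_of_le_one_right hCu.le (hη1 x))
    rw [JJ_const_smul _ _ hF, zero_add] at hq
    have hq2 : ∫ x, |g x - 0| * ‖fderiv ℝ χ x‖ = ∫ x, g x * ‖fderiv ℝ χ x‖ := by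
      refine integral_congr_ae (Eventually.of_forall fun x => ?_)
      simp only [sub_zero, abs_of_nonneg (h01 x).1]
    rw [hq2, inv_mul_le_iff₀ hCu] at hq
    have i1 : Integrable (fun x => g x * divN (fun y => χ y • η y) x) :=
      hg.integrable_div hΩ hF (hFs.trans hχΩ)
    have hle : JJ (fun x => g x * χ x) η ≤
        ∫ x, (g x * divN (fun y => χ y • η y) x + g x * ‖fderiv ℝ χ x‖) := by
      have i0 : Integrable (fun x => g x * χ x * divN η x) := by
        have := hg.integrable_mul (b := fun x => χ x * divN η x) hΩ
          (hχ.continuous.mul (divN_continuous hη.1)) hχc.mul_right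
          ((closure_mono fun x hx => left_ne_zero_of_mul hx).trans hχΩ)
        simpa only [mul_assoc] using this
      refine integral_mono i0 (i1.add hgn) fun x => ?_
      simp only
      rw [divN_smul (hχ.differentiable (by norm_num)) hη.diff]
      have : -(fderiv ℝ χ x (η x)) ≤ ‖fderiv ℝ χ x‖ := by
        refine (neg_le_abs _).trans ?_
        refine ((fderiv ℝ χ x).le_opNorm (η x)).trans ?_
        exact mul_le_of_le_one_right (norm_nonneg _) (hη1 x)
      nlinarith [mul_le_mul_of_nonneg_left this (h01 x).1]
    rw [integral_add i1 hgn] at hle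
    have hq3 : JJ g (fun x => χ x • η x) ≤ Cu * (C * (E * m)) :=
      hq.trans (mul_le_mul_of_nonneg_left (mul_le_mul_of_nonneg_left hgrad hC.le) hCu.le)
    have hq4 : ∫ x, g x * divN (fun y => χ y • η y) x ≤ Cu * (C * (E * m)) := hq3
    nlinarith
  have hw1 : ∀ x, 0 ≤ g x * χ x ∧ g x * χ x ≤ 1 := fun x =>
    ⟨mul_nonneg (h01 x).1 (hχ1 x).1, mul_le_one₀ (h01 x).2 (hχ1 x).1 (hχ1 x).2⟩
  have key := iso_avg hwi hχc.mul_left hw1 hP hs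
  rw [ball_vol hs] at key
  set V := volume.real (Metric.ball (0 : Rn n) 1) with hV
  have hV0 : 0 < V := by
    refine ENNReal.toReal_pos (Metric.measure_ball_pos _ _ one_pos).ne' measure_ball_lt_top.ne
  have hsV : 0 < s ^ n * V := by positivity
  have l1 : ∫ x in Metric.closedBall x0 ρ', g x ≤ ∫ x, g x * χ x * (g x * χ x) := by
    rw [← integral_indicator hmi']
    have hsub := Metric.closedBall_subset_closedBall (x := x0) hρ.le
    refine integral_mono ((hgi.mono_set hsub).integrable_indicator hmi') ?_ fun x => ?_
    · have := hg.integrable_mul (b := fun x => χ x * χ x) hΩ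
          (hχ.continuous.mul hχ.continuous) hχc.mul_right
          ((closure_mono fun x hx => left_ne_zero_of_mul hx).trans hχΩ)
      refine this.congr (Eventually.of_forall fun x => ?_)
      simp only
      rw [mul_mul_mul_comm, h11]
    · by_cases hx : x ∈ Metric.closedBall x0 ρ'
      · simp [indicator_of_mem hx, hχ2 x hx, h11]
      · simp only [indicator_of_notMem hx]
        exact mul_self_nonneg _
  have l2 : ∫ x, g x * χ x ≤ m := by
    rw [hmI]
    refine integral_mono hwi hgI fun x => ?_
    by_cases hx : x ∈ Metric.closedBall x0 ρ
    · simp only [indicator_of_mem hx]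
      exact mul_le_of_le_one_right (h01 x).1 (hχ1 x).2
    · simp [indicator_of_notMem hx, hχz x hx]
  have l3 : (∫ x, g x * χ x) ^ 2 ≤ m ^ 2 :=
    pow_le_pow_left₀ (integral_nonneg fun x => (hw1 x).1) l2 2
  have l4 : s ^ n * V * ∫ x in Metric.closedBall x0 ρ', g x ≤
      s ^ n * V * (s * ((Cu * C + 1) * (E * m))) + m ^ 2 :=
    (mul_le_mul_of_nonneg_left l1 hsV.le).trans (key.trans (add_le_add le_rfl l3))
  have l5 : s * ((Cu * C + 1) * E) * m + m ^ 2 / (s ^ n * V) =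
      (s ^ n * V * (s * ((Cu * C + 1) * (E * m))) + m ^ 2) / (s ^ n * V) := by
    field_simp
  rw [l5, le_div_iff₀ hsV, mul_comm]
  exact l4

end degiorgi

open MeasureTheory Set Filter

section locbdd
variable {n : ℕ}

lemma loc_ub {φ : Rn n → ℝ} {Ω : Set (Rn n)} (hφ : IsNormN φ) (hΩ : IsOpen Ω) {u : Rn n → ℝ}
    (hu : BVlocFun Ω u) (hmin : MinU φ Ω u) {x0 : Rn n} (hx0 : x0 ∈ Ω) :
    ∃ r > 0, ∃ M : ℝ, ∀ᵐ x, x ∈ Metric.closedBall x0 r → u x ≤ M := by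
  obtain ⟨C, hC, hl⟩ := hφ.lower
  obtain ⟨Cu, hCu, hup⟩ := hφ.upper
  obtain ⟨D, hD, hcut⟩ := cutoff_ball
  obtain ⟨R, hR, hRΩ⟩ := Metric.nhds_basis_closedBall.mem_iff.1 (hΩ.mem_nhds hx0)
  obtain ⟨r, hr, hrR⟩ : ∃ r > 0, R = 2 * r := ⟨R / 2, by positivity, by ring⟩
  rw [hrR] at hRΩ
  refine ⟨r, hr, ?_⟩
  set V := volume.real (Metric.ball (0 : Rn n) 1) with hV
  have hV0 : 0 < V :=
    ENNReal.toReal_pos (Metric.measure_ball_pos _ _ one_pos).ne' measure_ball_lt_top.ne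
  obtain ⟨K, hKd⟩ : ∃ K, K = (Cu * C + 1) * D := ⟨_, rfl⟩
  have hK : 0 < K := by rw [hKd]; positivity
  obtain ⟨Λ, hΛ⟩ : ∃ Λ : ℝ, Λ = (1 / 4) ^ (n + 1) := ⟨_, rfl⟩
  obtain ⟨s0, hs0⟩ : ∃ s0, s0 = Λ * r / (4 * K) := ⟨_, rfl⟩
  obtain ⟨μ, hμ⟩ : ∃ μ, μ = Λ * s0 ^ n * V / 2 := ⟨_, rfl⟩
  have hΛ0 : 0 < Λ := by rw [hΛ]; positivity
  have hΛ1 : Λ < 1 := by rw [hΛ]; exact pow_lt_one₀ (by norm_num) (by norm_num) (by simp)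
  have hs00 : 0 < s0 := by rw [hs0]; positivity
  have hμ0 : 0 < μ := by rw [hμ]; positivity
  let f : ℝ → ℝ → ℝ := fun t => (Ioi t).indicator 1
  have f01 : ∀ t y, 0 ≤ f t y ∧ f t y ≤ 1 := by
    intro t y
    simp only [f, indicator_apply]
    split_ifs <;> simp
  have f11 : ∀ t y, f t y * f t y = f t y := by
    intro t y
    simp only [f, indicator_apply]
    split_ifs <;> simp
  have fm : ∀ t, Monotone (f t) := by
    intro t y z hyz
    simp only [f, indicator_apply, mem_Ioi]
    split_ifs with h1 h2 h2
    · exact le_rfl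
    · exact absurd (h1.trans_le hyz) h2
    · simp
    · exact le_rfl
  have hgQ : ∀ t, LI Ω (fun x => f t (u x)) ∧ QQ φ Ω C (fun x => f t (u x)) := fun t =>
    QQ_bdd_mono hφ hΩ hl hC hu hmin (fm t) (M := 1) fun y => by
      rw [abs_of_nonneg (f01 t y).1]; exact (f01 t y).2
  -- smallness at level zero
  have hlim : Tendsto (fun N : ℕ => ∫ x in Metric.closedBall x0 (2 * r), f (N:ℝ) (u x)) atTop
      (nhds 0) := by
    have h := tendsto_integral_of_dominated_convergence
      (μ := volume.restrict (Metric.closedBall x0 (2 * r)))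
      (F := fun (N : ℕ) x => f (N:ℝ) (u x)) (f := fun _ => (0:ℝ)) (fun _ => (1:ℝ))
      (fun N => ((hgQ N).1.cball hΩ hRΩ).1) ?_ ?_ ?_
    · simpa using h
    · exact integrableOn_const (isCompact_closedBall x0 (2 * r)).measure_lt_top.ne
    · exact fun N => Eventually.of_forall fun x => by
        rw [Real.norm_eq_abs, abs_of_nonneg (f01 _ _).1]; exact (f01 _ _).2
    · refine Eventually.of_forall fun x => ?_
      obtain ⟨N0, hN0⟩ := exists_nat_ge (u x)
      refine tendsto_const_nhds.congr' ?_
      filter_upwards [eventually_ge_atTop N0] with N hN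
      have : ¬ ((N:ℝ) < u x) := not_lt.2 (hN0.trans (by exact_mod_cast hN))
      simp [f, this]
  obtain ⟨N, hN⟩ := (hlim.eventually (ge_mem_nhds hμ0)).exists
  refine ⟨N, ?_⟩
  obtain ⟨hg, hQ⟩ := hgQ N
  let ρ : ℕ → ℝ := fun k => r * (1 + (1 / 2) ^ k)
  have hρ2 : ∀ k, ρ k ≤ 2 * r := by
    intro k
    have : ((1:ℝ) / 2) ^ k ≤ 1 := pow_le_one₀ (by norm_num) (by norm_num)
    simp only [ρ]; nlinarith
  have hρr : ∀ k, r ≤ ρ k := by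
    intro k
    have : 0 < ((1:ℝ) / 2) ^ k := by positivity
    simp only [ρ]; nlinarith
  have hρd : ∀ k, ρ k - ρ (k + 1) = r * (1 / 2) ^ (k + 1) := by
    intro k; simp only [ρ, pow_succ]; ring
  have hbk : ∀ k, Metric.closedBall x0 (ρ k) ⊆ Ω := fun k =>
    (Metric.closedBall_subset_closedBall (hρ2 k)).trans hRΩ
  let m : ℕ → ℝ := fun k => ∫ x in Metric.closedBall x0 (ρ k), f N (u x)
  have hit := iteration (m := m) hK hV0 hr hΛ hs0 hμ
    (fun k => integral_nonneg fun x => (f01 _ _).1) (fun k s hs => by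
      have hlt : ρ (k + 1) < ρ k := by
        have := hρd k
        have h2 : 0 < r * (1 / 2) ^ (k + 1) := by positivity
        linarith
      obtain ⟨χ, c1, c2, c3, c4, c5, c6⟩ := hcut n x0 (ρ (k + 1)) (ρ k)
        (hr.trans_le (hρr _)) hlt
      have := dg_step hφ hΩ hCu hup hC hg hQ (fun x => f01 _ _) (fun x => f11 _ _) hlt (hbk k)
        c1 c2 c3 c4 c5 c6 hs
      rw [hρd k] at this
      rw [hKd, mul_div_assoc]
      exact this) (by simpa [m, ρ, mul_comm, one_add_one_eq_two] using hN)
  have hgr : IntegrableOn (fun x => f N (u x)) (Metric.closedBall x0 r) :=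
    hg.cball hΩ ((Metric.closedBall_subset_closedBall (by linarith)).trans hRΩ)
  have hle : ∀ k, ∫ x in Metric.closedBall x0 r, f N (u x) ≤ μ * Λ ^ k := fun k =>
    (setIntegral_mono_set (hg.cball hΩ (hbk k)) (Eventually.of_forall fun x => (f01 _ _).1)
      (Metric.closedBall_subset_closedBall (hρr k)).eventuallyLE).trans (hit k)
  have h0 : ∫ x in Metric.closedBall x0 r, f N (u x) = 0 := by
    refine le_antisymm ?_ (integral_nonneg fun x => (f01 _ _).1)
    have ht : Tendsto (fun k : ℕ => μ * Λ ^ k) atTop (nhds (μ * 0)) :=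
      (tendsto_pow_atTop_nhds_zero_of_lt_one hΛ0.le hΛ1).const_mul μ
    rw [mul_zero] at ht
    exact ge_of_tendsto' ht hle
  have hae := (integral_eq_zero_iff_of_nonneg (fun x => (f01 _ _).1) hgr).1 h0
  have hae2 := (ae_restrict_iff' measurableSet_closedBall).1 hae
  filter_upwards [hae2] with x hx hxb
  by_contra hc
  have := hx hxb
  simp [f, not_le.1 hc] at this

lemma loc_bdd {φ : Rn n → ℝ} {Ω : Set (Rn n)} (hφ : IsNormN φ) (hΩ : IsOpen Ω) {u : Rn n → ℝ}
    (hu : BVlocFun Ω u) (hmin : MinU φ Ω u) {K : Set (Rn n)} (hK : IsCompact K) (hKΩ : K ⊆ Ω) :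
    ∃ M : ℝ, ∀ᵐ x, x ∈ K → |u x| ≤ M := by
  refine hK.induction_on (p := fun s => ∃ M : ℝ, ∀ᵐ x, x ∈ s → |u x| ≤ M) ⟨0, by simp⟩ ?_ ?_ ?_
  · rintro s t hst ⟨M, hM⟩
    exact ⟨M, hM.mono fun x hx h => hx (hst h)⟩
  · rintro s t ⟨M, hM⟩ ⟨M', hM'⟩
    refine ⟨max M M', ?_⟩
    filter_upwards [hM, hM'] with x h1 h2 hx
    rcases hx with hx | hx
    · exact (h1 hx).trans (le_max_left _ _)
    · exact (h2 hx).trans (le_max_right _ _)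
  · intro x0 hx0
    obtain ⟨r, hr, M, hM⟩ := loc_ub hφ hΩ hu hmin (hKΩ hx0)
    obtain ⟨r', hr', M', hM'⟩ := loc_ub hφ hΩ hu.neg (hmin.neg hφ) (hKΩ hx0)
    refine ⟨Metric.closedBall x0 (min r r'), mem_nhdsWithin_of_mem_nhds
      (Metric.closedBall_mem_nhds _ (lt_min hr hr')), max M M', ?_⟩
    filter_upwards [hM, hM'] with x h1 h2 hx
    have a := h1 (Metric.closedBall_subset_closedBall (min_le_left _ _) hx)
    have b := h2 (Metric.closedBall_subset_closedBall (min_le_right _ _) hx)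
    rw [abs_le]
    constructor
    · linarith [le_max_right M M']
    · exact a.trans (le_max_left _ _)

lemma final_mono {φ : Rn n → ℝ} {Ω : Set (Rn n)} (hφ : IsNormN φ) (hΩ : IsOpen Ω) {u : Rn n → ℝ}
    (hu : BVlocFun Ω u) (hmin : MinU φ Ω u) {f : ℝ → ℝ} (hf : Monotone f) :
    BVlocFun Ω (fun x => f (u x)) ∧ MinU φ Ω (fun x => f (u x)) := by
  obtain ⟨C, hC, hl⟩ := hφ.lower
  have hclip : ∀ M : ℝ, (LI Ω fun x => f (max (-|M|) (min |M| (u x)))) ∧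
      QQ φ Ω C fun x => f (max (-|M|) (min |M| (u x))) := by
    intro M
    have hm : Monotone fun t => f (max (-|M|) (min |M| t)) := fun a b hab =>
      hf (max_le_max le_rfl (min_le_min le_rfl hab))
    refine QQ_bdd_mono hφ hΩ hl hC hu hmin hm (M := max |f (-|M|)| |f (|M|)|) fun t => ?_
    refine abs_le_max_abs_abs (hf (le_max_left _ _)) (hf (max_le ?_ (min_le_left _ _)))
    linarith [abs_nonneg M]
  have hcl : ∀ M t : ℝ, |t| ≤ M → max (-|M|) (min |M| t) = t := by
    intro M t h
    obtain ⟨h1, h2⟩ := abs_le.1 (h.trans (le_abs_self M))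
    rw [min_eq_right h2, max_eq_right h1]
  have hLI : LI Ω (fun x => f (u x)) := by
    intro A hA
    obtain ⟨M, hM⟩ := loc_bdd hφ hΩ hu hmin hA.2.1 hA.2.2
    refine ((hclip M).1 A hA).congr ?_
    rw [EventuallyEq, ae_restrict_iff' hA.1.measurableSet]
    filter_upwards [hM] with x hx hxA
    rw [hcl M _ (hx (subset_closure hxA))]
  have hQ : QQ φ Ω C (fun x => f (u x)) := by
    intro ψ p1 p2 p3 p4 v hv B hB η hη hηψ
    obtain ⟨M, hM⟩ := loc_bdd hφ hΩ hu hmin p2 p3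
    have h := (hclip M).2 ψ p1 p2 p3 p4 v hv B hB η hη hηψ
    have e1 : JJ (fun x => f (u x)) η = JJ (fun x => f (max (-|M|) (min |M| (u x)))) η := by
      refine integral_congr_ae ?_
      filter_upwards [hM] with x hx
      by_cases hxs : x ∈ tsupport ψ
      · rw [hcl M _ (hx hxs)]
      · rw [divN_eq_zero fun h => hxs (tsupport_sub_of hφ hηψ h)]; simp
    have e2 : ∫ x, |f (u x) - v x| * ‖fderiv ℝ ψ x‖ =
        ∫ x, |f (max (-|M|) (min |M| (u x))) - v x| * ‖fderiv ℝ ψ x‖ := by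
      refine integral_congr_ae ?_
      filter_upwards [hM] with x hx
      by_cases hxs : x ∈ tsupport ψ
      · rw [hcl M _ (hx hxs)]
      · have : fderiv ℝ ψ x = 0 := by
          by_contra h
          exact hxs (support_fderiv_subset ℝ (by simpa using h))
        simp [this]
    rw [e1, e2]
    exact h
  exact ⟨hQ.bound hφ hΩ hLI, hQ.toMinU hφ⟩

end locbdd

theorem minG_comp_monotone {n : ℕ} (Φ : Rn1 n → ℝ) (φ : Rn n → ℝ)
    (hΦ : IsNorm1 Φ) (hφ : IsNormN φ) (hcyl : Cylindrical Φ φ)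
    (Ω : Set (Rn n)) (hΩ : IsOpen Ω) (u : Rn n → ℝ) (hmin : MinG Φ Ω u)
    (f : ℝ → ℝ) (hf : Monotone f ∨ Antitone f) :
    BVlocFun Ω (f ∘ u) ∧ MinG Φ Ω (f ∘ u) := by
  have key : BVlocFun Ω (f ∘ u) ∧ MinU φ Ω (f ∘ u) := by
    obtain ⟨hu, hm⟩ := (minG_iff hφ hcyl hΩ).1 hmin
    rcases hf with hf | hf
    · exact final_mono hφ hΩ hu hm hf
    · obtain ⟨h1, h2⟩ := final_mono hφ hΩ hu hm (f := fun t => -f t)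
        (fun a b hab => neg_le_neg (hf hab))
      have e : f ∘ u = fun x => - (fun x => - f (u x)) x := by funext x; simp
      rw [e]
      exact ⟨h1.neg, h2.neg hφ⟩
  exact ⟨key.1, (minG_iff hφ hcyl hΩ).2 key⟩
end

section
/- Let Φ be a norm on ℝ^{n+1} cylindrical over a norm φ on ℝ^n. Let H_1, H_2 ⊂ ℝ^{n+1} be closed half-spaces with outer unit normals ν_1, ν_2 ∈ S^n, such that 0 ∈ ∂H_1 ∩ ∂H_2 ⊆ {(x,t) : t = 0}, and assume: (a) ν_1·ν_2 ≥ 0 and ν_2·e_{n+1} ≥ ν_1·e_{n+1} ≥ 0, where e_{n+1} = (0,…,0,1); (b) arccos(ν_1·ν_2) + arccos(ν_2·e_{n+1}) = arccos(ν_1·e_{n+1}). Then both E = H_1 ∩ H_2 and F = H_1 ∪ H_2 are minimizers of P_Φ in ℝ^{n+1}. -/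
open MeasureTheory Set Filter

section Aux
open scoped Manifold Topology

lemma aux_dotp_add_left {n : ℕ} (x y z : Rn1 n) : dotp (x + y) z = dotp x z + dotp y z := by
  simp only [dotp, dotn, Prod.fst_add, Prod.snd_add, PiLp.add_apply, add_mul,
    Finset.sum_add_distrib]
  ring

lemma aux_dotp_smul_left {n : ℕ} (c : ℝ) (x z : Rn1 n) : dotp (c • x) z = c * dotp x z := by
  simp only [dotp, dotn, Prod.smul_fst, Prod.smul_snd, PiLp.smul_apply, smul_eq_mul, mul_add,
    Finset.mul_sum, mul_assoc]

lemma aux_dotp_comm {n : ℕ} (x y : Rn1 n) : dotp x y = dotp y x := by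
  simp only [dotp, dotn, mul_comm]

/-- Dot product with a fixed vector as a linear map. -/
noncomputable def auxL {n : ℕ} (ν : Rn1 n) : Rn1 n →L[ℝ] ℝ :=
  LinearMap.toContinuousLinearMap
    { toFun := fun z => dotp z ν
      map_add' := fun x y => aux_dotp_add_left x y ν
      map_smul' := fun c x => aux_dotp_smul_left c x ν }

lemma auxL_apply {n : ℕ} (ν z : Rn1 n) : auxL ν z = dotp z ν := rfl

lemma aux_dotn_inner {n : ℕ} (x y : Rn n) : dotn x y = inner ℝ x y := by
  simp [dotn, PiLp.inner_apply, mul_comm]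

lemma aux_decomp {n : ℕ} (L : Rn1 n →L[ℝ] ℝ) (X : Rn1 n) :
    L X = (∑ i, L (EuclideanSpace.single i (1:ℝ), (0:ℝ)) * X.1 i)
      + L ((0 : Rn n), (1:ℝ)) * X.2 := by
  have h1 : X = (∑ i, X.1 i • ((EuclideanSpace.single i (1:ℝ) : Rn n), (0:ℝ)))
      + X.2 • ((0 : Rn n), (1:ℝ)) := by
    ext j
    · simp [Prod.fst_sum, Finset.sum_apply, Pi.single_apply]
    · simp [Prod.snd_sum]
  conv_lhs => rw [h1]
  simp only [map_add, map_sum, map_smul, smul_eq_mul, mul_comm]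

lemma aux_div_add {n : ℕ} {X Y : Rn1 n → Rn1 n} (hX : ContDiff ℝ 1 X) (hY : ContDiff ℝ 1 Y)
    (z : Rn1 n) : div1 (fun z => X z + Y z) z = div1 X z + div1 Y z := by
  have h : fderiv ℝ (fun z => X z + Y z) z = fderiv ℝ X z + fderiv ℝ Y z :=
    fderiv_fun_add (hX.differentiable one_ne_zero z) (hY.differentiable one_ne_zero z)
  simp only [div1, h, add_apply, Prod.fst_add, Prod.snd_add, PiLp.add_apply,
    Finset.sum_add_distrib]
  ring

lemma aux_div_smul {n : ℕ} {f : Rn1 n → ℝ} {X : Rn1 n → Rn1 n} (hf : ContDiff ℝ 1 f)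
    (hX : ContDiff ℝ 1 X) (z : Rn1 n) :
    div1 (fun z => f z • X z) z = fderiv ℝ f z (X z) + f z * div1 X z := by
  have h : fderiv ℝ (fun z => f z • X z) z = f z • fderiv ℝ X z + (fderiv ℝ f z).smulRight (X z) :=
    fderiv_fun_smul (hf.differentiable one_ne_zero z) (hX.differentiable one_ne_zero z)
  rw [aux_decomp (fderiv ℝ f z) (X z)]
  simp only [div1, h, add_apply, smul_apply,
    ContinuousLinearMap.smulRight_apply, Prod.fst_add, Prod.snd_add, PiLp.add_apply,
    Prod.smul_fst, Prod.smul_snd, PiLp.smul_apply, smul_eq_mul,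
    Finset.sum_add_distrib, mul_add, Finset.mul_sum]
  ring

lemma aux_div_const_smul {n : ℕ} (c : ℝ) {X : Rn1 n → Rn1 n}
    (hX : ContDiff ℝ 1 X) (z : Rn1 n) :
    div1 (fun z => c • X z) z = c * div1 X z := by
  rw [aux_div_smul (f := fun _ => c) contDiff_const hX]
  simp

lemma aux_div_cont {n : ℕ} {X : Rn1 n → Rn1 n} (hX : ContDiff ℝ 1 X) :
    Continuous (div1 X) := by
  have h := hX.continuous_fderiv one_ne_zero
  unfold div1
  fun_prop

lemma aux_div_supp {n : ℕ} {X : Rn1 n → Rn1 n} (hc : HasCompactSupport X) :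
    HasCompactSupport (div1 X) := by
  refine (hc.fderiv (𝕜 := ℝ)).comp_left (g := fun L : Rn1 n →L[ℝ] Rn1 n =>
    (∑ i, (L (EuclideanSpace.single i (1:ℝ), (0:ℝ))).1 i) + (L ((0 : Rn n), (1:ℝ))).2) ?_
  simp

lemma aux_div_int {n : ℕ} {X : Rn1 n → Rn1 n} (hX : ContDiff ℝ 1 X) (hc : HasCompactSupport X) :
    Integrable (div1 X) :=
  (aux_div_cont hX).integrable_of_hasCompactSupport (aux_div_supp hc)

lemma aux_int_fderiv {n : ℕ} {g : Rn1 n → ℝ} (hg : ContDiff ℝ 1 g) (hc : HasCompactSupport g)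
    (v : Rn1 n) : Integrable (fun x => fderiv ℝ g x v) ∧ ∫ x, fderiv ℝ g x v = 0 := by
  have hi : Integrable (fun x => fderiv ℝ g x v) := by
    refine Continuous.integrable_of_hasCompactSupport ?_ ?_
    · have h := hg.continuous_fderiv one_ne_zero
      fun_prop
    · exact (hc.fderiv (𝕜 := ℝ)).comp_left (g := fun L : Rn1 n →L[ℝ] ℝ => L v) (by simp)
  refine ⟨hi, ?_⟩
  have : (volume : Measure (Rn1 n)).IsAddHaarMeasure :=
    inferInstanceAs (((volume : Measure (Rn n)).prod (volume : Measure ℝ)).IsAddHaarMeasure)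
  have := integral_mul_fderiv_eq_neg_fderiv_mul_of_integrable (μ := (volume : Measure (Rn1 n)))
    (f := fun _ => (1:ℝ)) (g := g) (v := v)
    (by simp) (by simpa using hi)
    (by simpa using hg.continuous.integrable_of_hasCompactSupport hc)
    (fun x _ => by fun_prop) (fun x _ => hg.differentiable one_ne_zero x)
  simpa using this

lemma aux_int_div {n : ℕ} {X : Rn1 n → Rn1 n} (hX : ContDiff ℝ 1 X) (hc : HasCompactSupport X) :
    ∫ z, div1 X z = 0 := by
  have hi : ∀ i, ContDiff ℝ 1 (fun z => (X z).1 i) := fun i => by fun_prop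
  have h2 : ContDiff ℝ 1 (fun z => (X z).2) := by fun_prop
  have ci : ∀ i, HasCompactSupport (fun z => (X z).1 i) := fun i =>
    hc.comp_left (g := fun y : Rn1 n => y.1 i) (by simp)
  have c2 : HasCompactSupport (fun z => (X z).2) :=
    hc.comp_left (g := fun y : Rn1 n => y.2) (by simp)
  have e : ∀ z, div1 X z = (∑ i, fderiv ℝ (fun z => (X z).1 i) z
      (EuclideanSpace.single i (1:ℝ), (0:ℝ)))
      + fderiv ℝ (fun z => (X z).2) z ((0 : Rn n), (1:ℝ)) := by
    intro z
    have hd := (hX.differentiable one_ne_zero z).hasFDerivAt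
    unfold div1
    congr 1
    · refine Finset.sum_congr rfl fun i _ => ?_
      have := (((EuclideanSpace.proj (𝕜 := ℝ) i).comp
        (ContinuousLinearMap.fst ℝ (Rn n) ℝ)).hasFDerivAt (x := X z)).comp z hd
      have h3 : fderiv ℝ (fun z => (X z).1 i) z = _ := this.fderiv
      rw [h3]; rfl
    · have := ((ContinuousLinearMap.snd ℝ (Rn n) ℝ).hasFDerivAt (x := X z)).comp z hd
      have h3 : fderiv ℝ (fun z => (X z).2) z = _ := this.fderiv
      rw [h3]; rfl
  simp_rw [e]
  rw [integral_add (integrable_finsetSum _ fun i _ => (aux_int_fderiv (hi i) (ci i) _).1)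
    (aux_int_fderiv h2 c2 _).1,
    integral_finsetSum _ fun i _ => (aux_int_fderiv (hi i) (ci i) _).1]
  simp [(aux_int_fderiv h2 c2 _).2, (aux_int_fderiv (hi _) (ci _) _).2]

lemma aux_nonneg {n : ℕ} {f : Rn1 n → ℝ} {X : Rn1 n → Rn1 n} (hf : ContDiff ℝ 1 f)
    (hX : ContDiff ℝ 1 X) (hc : HasCompactSupport X) (h : ∀ z, fderiv ℝ f z (X z) ≤ 0) :
    0 ≤ ∫ z, f z * div1 X z := by
  have hfX : ContDiff ℝ 1 (fun z => f z • X z) := hf.smul hX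
  have hfc : HasCompactSupport (fun z => f z • X z) := hc.smul_left (f := f)
  have h0 := aux_int_div hfX hfc
  have hi : Integrable (fun z => f z * div1 X z) :=
    (hf.continuous.mul (aux_div_cont hX)).integrable_of_hasCompactSupport
      ((aux_div_supp hc).mul_left)
  have hi2 : Integrable (fun z => fderiv ℝ f z (X z)) := by
    have := (aux_div_int hfX hfc).sub hi
    refine this.congr (Eventually.of_forall fun z => ?_)
    simp [aux_div_smul hf hX]
  simp_rw [aux_div_smul hf hX] at h0
  rw [integral_add hi2 hi] at h0
  have : ∫ z, fderiv ℝ f z (X z) ≤ 0 := integral_nonpos h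
  linarith

/-- smooth decreasing approximation of the indicator of `(-∞,0]`. -/
noncomputable def auxg (k : ℕ) (s : ℝ) : ℝ := 1 - Real.smoothTransition (k * s)

lemma auxg_contDiff (k : ℕ) : ContDiff ℝ 1 (auxg k) := by
  have : ContDiff ℝ 1 Real.smoothTransition := Real.smoothTransition.contDiff (n := 1)
  unfold auxg
  exact contDiff_const.sub (this.comp (contDiff_const.mul contDiff_id))

lemma auxg_nonneg (k : ℕ) (s : ℝ) : 0 ≤ auxg k s := by
  have := Real.smoothTransition.le_one (k * s); unfold auxg; linarith

lemma auxg_le (k : ℕ) (s : ℝ) : auxg k s ≤ 1 := by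
  have := Real.smoothTransition.nonneg (k * s); unfold auxg; linarith

lemma auxg_deriv (k : ℕ) (s : ℝ) : deriv (auxg k) s ≤ 0 := by
  refine Antitone.deriv_nonpos ?_
  intro a b hab
  have := Real.smoothTransition.monotone (mul_le_mul_of_nonneg_left hab (Nat.cast_nonneg k))
  unfold auxg; linarith

lemma auxg_ev (s : ℝ) : ∀ᶠ k : ℕ in atTop, auxg k s = (Iic (0:ℝ)).indicator 1 s := by
  by_cases hs : s ≤ 0
  · refine Eventually.of_forall fun k => ?_
    rw [indicator_of_mem (by exact hs), auxg, Real.smoothTransition.zero_of_nonpos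
      (mul_nonpos_of_nonneg_of_nonpos (Nat.cast_nonneg k) hs)]
    simp
  · push Not at hs
    obtain ⟨m, hm⟩ := exists_nat_gt (1 / s)
    filter_upwards [eventually_ge_atTop m] with k hk
    have : (1:ℝ) ≤ k * s := by
      have h1 : (m:ℝ) ≤ k := by exact_mod_cast hk
      rw [div_lt_iff₀ hs] at hm
      nlinarith
    rw [indicator_of_notMem (by simpa using hs), auxg, Real.smoothTransition.one_of_one_le this]
    simp

lemma auxg_hasFDeriv {n : ℕ} (k : ℕ) (ν z : Rn1 n) :
    HasFDerivAt (fun z => auxg k (dotp z ν)) (deriv (auxg k) (dotp z ν) • auxL ν) z := by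
  have h1 : HasDerivAt (auxg k) (deriv (auxg k) (dotp z ν)) (auxL ν z) :=
    ((auxg_contDiff k).differentiable one_ne_zero _).hasDerivAt
  exact h1.comp_hasFDerivAt z (auxL ν).hasFDerivAt

lemma auxg_comp_contDiff {n : ℕ} (k : ℕ) (ν : Rn1 n) :
    ContDiff ℝ 1 (fun z => auxg k (dotp z ν)) :=
  (auxg_contDiff k).comp (auxL ν).contDiff

/-- Property that the Gauss-Green inequality holds. -/
def auxGG {n : ℕ} (ν₁ ν₂ : Rn1 n) (E : Set (Rn1 n)) : Prop :=
  ∀ X : Rn1 n → Rn1 n, ContDiff ℝ 1 X → HasCompactSupport X →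
    (∀ z, 0 ≤ dotp (X z) ν₁) → (∀ z, 0 ≤ dotp (X z) ν₂) → 0 ≤ ∫ z in E, div1 X z

lemma aux_limit {n : ℕ} {E : Set (Rn1 n)} (hE : MeasurableSet E) {f : ℕ → Rn1 n → ℝ}
    {X : Rn1 n → Rn1 n} (hX : ContDiff ℝ 1 X) (hc : HasCompactSupport X)
    (hf : ∀ k, ContDiff ℝ 1 (f k)) (hb : ∀ k z, |f k z| ≤ 1)
    (hev : ∀ z, ∀ᶠ k in atTop, f k z = E.indicator 1 z)
    (hd : ∀ k z, fderiv ℝ (f k) z (X z) ≤ 0) : 0 ≤ ∫ z in E, div1 X z := by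
  have ht : Tendsto (fun k => ∫ z, f k z * div1 X z) atTop
      (𝓝 (∫ z, E.indicator (div1 X) z)) := by
    refine tendsto_integral_of_dominated_convergence (fun z => |div1 X z|) ?_ ?_ ?_ ?_
    · intro k
      exact ((hf k).continuous.mul (aux_div_cont hX)).aestronglyMeasurable
    · exact (aux_div_int hX hc).abs
    · refine fun k => Eventually.of_forall fun z => ?_
      rw [Real.norm_eq_abs, abs_mul]
      exact mul_le_of_le_one_left (abs_nonneg _) (hb k z)
    · refine Eventually.of_forall fun z => ?_
      refine tendsto_const_nhds.congr' ?_
      filter_upwards [hev z] with k hk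
      rw [hk]
      by_cases hz : z ∈ E <;> simp [hz]
  rw [integral_indicator hE] at ht
  exact ge_of_tendsto' ht fun k => aux_nonneg (hf k) hX hc (hd k)

lemma aux_meas {n : ℕ} (ν : Rn1 n) : MeasurableSet {z : Rn1 n | dotp z ν ≤ 0} :=
  (isClosed_le (auxL ν).continuous continuous_const).measurableSet

lemma aux_inter {n : ℕ} (ν₁ ν₂ : Rn1 n) :
    auxGG ν₁ ν₂ ({z | dotp z ν₁ ≤ 0} ∩ {z | dotp z ν₂ ≤ 0}) := by
  intro X hX hc h1 h2
  refine aux_limit ((aux_meas ν₁).inter (aux_meas ν₂))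
    (f := fun k z => auxg k (dotp z ν₁) * auxg k (dotp z ν₂)) hX hc ?_ ?_ ?_ ?_
  · exact fun k => (auxg_comp_contDiff k ν₁).mul (auxg_comp_contDiff k ν₂)
  · intro k z
    rw [abs_of_nonneg (mul_nonneg (auxg_nonneg _ _) (auxg_nonneg _ _))]
    exact mul_le_one₀ (auxg_le _ _) (auxg_nonneg _ _) (auxg_le _ _)
  · intro z
    filter_upwards [auxg_ev (dotp z ν₁), auxg_ev (dotp z ν₂)] with k e1 e2
    rw [e1, e2]
    by_cases a : dotp z ν₁ ≤ 0 <;> by_cases b : dotp z ν₂ ≤ 0 <;> simp [indicator, a, b]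
  · intro k z
    rw [((auxg_hasFDeriv k ν₁ z).fun_mul (auxg_hasFDeriv k ν₂ z)).fderiv]
    simp only [add_apply, smul_apply, auxL_apply,
      smul_eq_mul]
    have a1 := mul_nonpos_of_nonpos_of_nonneg (auxg_deriv k (dotp z ν₁)) (h1 z)
    have a2 := mul_nonpos_of_nonpos_of_nonneg (auxg_deriv k (dotp z ν₂)) (h2 z)
    have b1 := mul_nonpos_of_nonneg_of_nonpos (auxg_nonneg k (dotp z ν₂)) a1
    have b2 := mul_nonpos_of_nonneg_of_nonpos (auxg_nonneg k (dotp z ν₁)) a2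
    linarith

lemma aux_union {n : ℕ} (ν₁ ν₂ : Rn1 n) :
    auxGG ν₁ ν₂ ({z | dotp z ν₁ ≤ 0} ∪ {z | dotp z ν₂ ≤ 0}) := by
  intro X hX hc h1 h2
  refine aux_limit ((aux_meas ν₁).union (aux_meas ν₂))
    (f := fun k z => (auxg k (dotp z ν₁) + auxg k (dotp z ν₂))
      - auxg k (dotp z ν₁) * auxg k (dotp z ν₂)) hX hc ?_ ?_ ?_ ?_
  · exact fun k => ((auxg_comp_contDiff k ν₁).add (auxg_comp_contDiff k ν₂)).sub
      ((auxg_comp_contDiff k ν₁).mul (auxg_comp_contDiff k ν₂))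
  · intro k z
    have a1 := auxg_nonneg k (dotp z ν₁)
    have a2 := auxg_nonneg k (dotp z ν₂)
    have b1 := auxg_le k (dotp z ν₁)
    have b2 := auxg_le k (dotp z ν₂)
    rw [abs_le]
    constructor <;> nlinarith
  · intro z
    filter_upwards [auxg_ev (dotp z ν₁), auxg_ev (dotp z ν₂)] with k e1 e2
    rw [e1, e2]
    by_cases a : dotp z ν₁ ≤ 0 <;> by_cases b : dotp z ν₂ ≤ 0 <;> simp [indicator, a, b]
  · intro k z
    rw [(((auxg_hasFDeriv k ν₁ z).fun_add (auxg_hasFDeriv k ν₂ z)).fun_sub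
      ((auxg_hasFDeriv k ν₁ z).fun_mul (auxg_hasFDeriv k ν₂ z))).fderiv]
    simp only [add_apply, sub_apply,
      smul_apply, auxL_apply, smul_eq_mul]
    have a1 := mul_nonpos_of_nonpos_of_nonneg (auxg_deriv k (dotp z ν₁)) (h1 z)
    have a2 := mul_nonpos_of_nonpos_of_nonneg (auxg_deriv k (dotp z ν₂)) (h2 z)
    have b1 := mul_nonpos_of_nonneg_of_nonpos (sub_nonneg.2 (auxg_le k (dotp z ν₂))) a1
    have b2 := mul_nonpos_of_nonneg_of_nonpos (sub_nonneg.2 (auxg_le k (dotp z ν₁))) a2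
    linarith

lemma aux_cutoff {n : ℕ} {K A : Set (Rn1 n)} (hK : IsCompact K) (hA : IsOpen A) (hKA : K ⊆ A) :
    ∃ χ : Rn1 n → ℝ, ContDiff ℝ 1 χ ∧ tsupport χ ⊆ A ∧ (∀ z, 0 ≤ χ z ∧ χ z ≤ 1) ∧
      ∃ U, IsOpen U ∧ K ⊆ U ∧ ∀ z ∈ U, χ z = 1 := by
  obtain ⟨f, h0, h1, hf⟩ := exists_contMDiffMap_zero_one_nhds_of_isClosed 𝓘(ℝ, Rn1 n)
    (n := 1) hA.isClosed_compl hK.isClosed (by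
      rw [← subset_compl_iff_disjoint_left, compl_compl]; exact hKA)
  refine ⟨f, f.contMDiff.contDiff, ?_, fun z => hf z, ?_⟩
  · intro z hz
    by_contra hzA
    rw [eventually_nhdsSet_iff_forall] at h0
    have := h0 z hzA
    exact (notMem_tsupport_iff_eventuallyEq.2 this) hz
  · obtain ⟨U, hU, hKU, h⟩ := eventually_nhdsSet_iff_exists.1 h1
    exact ⟨U, hU, hKU, h⟩


lemma aux_bdd {n : ℕ} {Φ : Rn1 n → ℝ} (hΦ : IsNorm1 Φ) {F A : Set (Rn1 n)}
    (h : BddAbove (perSet1 enorm1 F A)) : BddAbove (perSet1 Φ F A) := by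
  obtain ⟨_, _, c, hc, hcΦ⟩ := hΦ
  obtain ⟨M, hM⟩ := h
  refine ⟨M / c, ?_⟩
  rintro r ⟨η, ⟨h1, h2, h3, h4⟩, rfl⟩
  have hs : tsupport (fun z => c • η z) ⊆ tsupport η := by
    refine closure_mono fun z hz hz' => hz ?_
    simp [hz']
  have := hM ⟨fun z => c • η z, ⟨h1.const_smul c,
    HasCompactSupport.smul_left (f := fun _ => c) h2, hs.trans h3, fun z => ?_⟩, rfl⟩
  · simp_rw [aux_div_const_smul c h1] at this
    rw [integral_const_mul] at this
    rw [le_div_iff₀ hc]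
    linarith
  · refine le_trans ?_ ((hcΦ (η z)).trans (h4 z))
    rw [enorm1, enorm1, aux_dotp_smul_left, aux_dotp_comm, aux_dotp_smul_left, ← mul_assoc,
      Real.sqrt_mul (mul_self_nonneg c), Real.sqrt_mul_self hc.le]

lemma aux_dotp_inner {n : ℕ} (x y : Rn1 n) :
    dotp x y = inner ℝ (WithLp.toLp 2 x) (WithLp.toLp 2 y) := by
  simp [dotp, aux_dotn_inner, WithLp.prod_inner_apply, mul_comm]

lemma aux_cs {n : ℕ} {x y : Rn1 n} (hx : enorm1 x ≤ 1) (hy : enorm1 y = 1) : -1 ≤ dotp x y := by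
  have e : ∀ x : Rn1 n, enorm1 x = ‖WithLp.toLp 2 x‖ := by
    intro x
    rw [enorm1, aux_dotp_inner, real_inner_self_eq_norm_sq, Real.sqrt_sq (norm_nonneg _)]
  rw [e] at hx hy
  rw [aux_dotp_inner]
  have := abs_real_inner_le_norm (WithLp.toLp 2 x) (WithLp.toLp 2 y)
  rw [hy, mul_one] at this
  linarith [(abs_le.1 (this.trans hx)).1]

lemma aux_dotp_self {n : ℕ} {x : Rn1 n} (h : enorm1 x = 1) : dotp x x = 1 := by
  rw [enorm1, Real.sqrt_eq_one] at h
  exact h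

lemma aux_BV {n : ℕ} {ν₁ ν₂ : Rn1 n} (hν₁ : enorm1 ν₁ = 1) (hν₂ : enorm1 ν₂ = 1)
    (ha : 0 ≤ dotp ν₁ ν₂) {E : Set (Rn1 n)} (hE : auxGG ν₁ ν₂ E) : BVlocSet1 univ E := by
  intro A ⟨hA, hAc, _⟩
  obtain ⟨V, hVo, hVs, hVc⟩ := exists_isOpen_superset_and_isCompact_closure hAc
  obtain ⟨χ, hχ, hχs, hχ01, U, hU, hAU, hχ1⟩ := aux_cutoff hAc hVo hVs
  have hχc : HasCompactSupport χ := by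
    exact hVc.of_isClosed_subset (isClosed_tsupport χ) (hχs.trans subset_closure)
  set Y : Rn1 n → Rn1 n := fun z => χ z • (ν₁ + ν₂) with hY
  have hYd : ContDiff ℝ 1 Y := hχ.smul contDiff_const
  have hYc : HasCompactSupport Y := hχc.smul_right (f' := fun _ => ν₁ + ν₂)
  refine ⟨∫ z in E, div1 Y z, ?_⟩
  rintro r ⟨η, ⟨h1, h2, h3, h4⟩, rfl⟩
  have key : ∀ ν : Rn1 n, enorm1 ν = 1 → 1 ≤ dotp (ν₁ + ν₂) ν →
      ∀ z, 0 ≤ dotp (Y z + η z) ν := by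
    intro ν hν h z
    rw [aux_dotp_add_left, hY, aux_dotp_smul_left]
    by_cases hz : z ∈ A
    · rw [hχ1 z (hAU (subset_closure hz))]
      have := aux_cs (h4 z) hν
      linarith
    · have : η z = 0 := by
        by_contra hne
        exact hz (h3 (subset_tsupport _ hne))
      have h0 : dotp (η z) ν = 0 := by
        rw [this]; exact (auxL ν).map_zero
      rw [h0, add_zero]
      exact mul_nonneg (hχ01 z).1 (by linarith)
  have := hE (fun z => Y z + η z) (hYd.add h1) (hYc.add h2)
    (key ν₁ hν₁ (by
      rw [aux_dotp_add_left, aux_dotp_self hν₁, aux_dotp_comm ν₂]; linarith))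
    (key ν₂ hν₂ (by
      rw [aux_dotp_add_left, aux_dotp_self hν₂]; linarith))
  simp_rw [aux_div_add hYd h1] at this
  rw [integral_add (aux_div_int hYd hYc).integrableOn (aux_div_int h1 h2).integrableOn] at this
  linarith

lemma aux_min {n : ℕ} {Φ : Rn1 n → ℝ} (hΦ : IsNorm1 Φ) {ν₁ ν₂ : Rn1 n} (hν₁ : enorm1 ν₁ = 1)
    (hν₂ : enorm1 ν₂ = 1) (ha : 0 ≤ dotp ν₁ ν₂) {E : Set (Rn1 n)} (hE : auxGG ν₁ ν₂ E)
    {N : Rn1 n} (hN : Φ N ≤ 1) (hN1 : ∀ ξ, Φ ξ ≤ 1 → 0 ≤ dotp (N + ξ) ν₁)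
    (hN2 : ∀ ξ, Φ ξ ≤ 1 → 0 ≤ dotp (N + ξ) ν₂) : MinPer1 Φ univ E := by
  refine ⟨aux_BV hν₁ hν₂ ha hE, ?_⟩
  intro A hA F hF hK hKA
  have hΦ0 : Φ 0 = 0 := by
    have := hΦ.2.1 0 0
    simpa using this
  refine csSup_le ⟨_, fun _ => 0, ⟨contDiff_const, HasCompactSupport.zero, by simp [tsupport],
    fun z => by simp [hΦ0]⟩, rfl⟩ ?_
  rintro r ⟨η, ⟨h1, h2, h3, h4⟩, rfl⟩
  obtain ⟨χ, hχ, hχs, hχ01, U, hU, hKU, hχ1⟩ := aux_cutoff hK hA.1 hKA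
  have hχc : HasCompactSupport χ :=
    hA.2.1.of_isClosed_subset (isClosed_tsupport χ) (hχs.trans subset_closure)
  set X : Rn1 n → Rn1 n := fun z => χ z • (N + η z) with hX
  have hXd : ContDiff ℝ 1 X := hχ.smul (contDiff_const.add h1)
  have hXc : HasCompactSupport X := hχc.smul_right (f' := fun z => N + η z)
  have hX0 := hE X hXd hXc
    (fun z => by
      rw [hX, aux_dotp_smul_left]; exact mul_nonneg (hχ01 z).1 (hN1 _ (h4 z)))
    (fun z => by
      rw [hX, aux_dotp_smul_left]; exact mul_nonneg (hχ01 z).1 (hN2 _ (h4 z)))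
  have hX'd : ContDiff ℝ 1 (fun z => (-1:ℝ) • X z) := hXd.const_smul (-1:ℝ)
  have hX'c : HasCompactSupport (fun z => (-1:ℝ) • X z) :=
    HasCompactSupport.smul_left (f := fun _ => (-1:ℝ)) hXc
  set Z : Rn1 n → Rn1 n := fun z => η z + (-1:ℝ) • X z with hZ
  have hZd : ContDiff ℝ 1 Z := h1.add hX'd
  have hZc : HasCompactSupport Z := h2.add hX'c
  have hZform : ∀ z, Z z = (1 - χ z) • η z + χ z • (-1:ℝ) • N := by
    intro z
    simp only [hZ, hX]
    module
  have hZs : tsupport Z ⊆ A := by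
    have : tsupport Z ⊆ tsupport η ∪ tsupport χ := by
      rw [tsupport, tsupport, tsupport, ← closure_union]
      refine closure_mono fun z hz => ?_
      by_contra hn
      simp only [mem_union, Function.mem_support, not_or, not_not] at hn
      apply hz
      rw [hZform, hn.1, hn.2]
      simp
    exact this.trans (union_subset h3 hχs)
  have hZb : ∀ z, Φ (Z z) ≤ 1 := by
    intro z
    rw [hZform]
    have hc := hΦ.1.2 (mem_univ (η z)) (mem_univ ((-1:ℝ) • N))
      (sub_nonneg.2 (hχ01 z).2) (hχ01 z).1 (by ring)
    refine hc.trans ?_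
    have hNN : Φ ((-1:ℝ) • N) ≤ 1 := by
      rw [hΦ.2.1]; simpa using hN
    simp only [smul_eq_mul]
    have a1 := mul_le_mul_of_nonneg_left (h4 z) (sub_nonneg.2 (hχ01 z).2)
    have a2 := mul_le_mul_of_nonneg_left hNN (hχ01 z).1
    linarith
  have hdivU : ∀ z ∈ U, div1 Z z = 0 := by
    intro z hz
    have : Z =ᶠ[𝓝 z] fun _ => (-1:ℝ) • N := by
      filter_upwards [hU.mem_nhds hz] with w hw
      rw [hZform, hχ1 w hw]
      simp
    have hfd : fderiv ℝ Z z = 0 := by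
      rw [this.fderiv_eq]; simp
    simp [div1, hfd]
  have hloc : ∀ G : Set (Rn1 n), ∫ z in G, div1 Z z = ∫ z in Uᶜ ∩ G, div1 Z z := by
    intro G
    rw [← Measure.restrict_restrict hU.measurableSet.compl]
    exact (setIntegral_eq_integral_of_forall_compl_eq_zero fun z hz =>
      hdivU z (by simpa using hz)).symm
  have hsets : Uᶜ ∩ E = Uᶜ ∩ F := by
    ext z
    refine and_congr_right fun hz => ?_
    have : z ∉ symmDiff E F := fun h => hz (hKU (subset_closure h))
    rw [mem_symmDiff] at this
    tauto
  have hEF : ∫ z in E, div1 Z z = ∫ z in F, div1 Z z := by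
    rw [hloc E, hloc F, hsets]
  have hle : -∫ z in F, div1 Z z ≤ Per1 Φ F A :=
    le_csSup (aux_bdd hΦ (hF A hA)) ⟨Z, ⟨hZd, hZc, hZs, hZb⟩, rfl⟩
  refine le_trans ?_ hle
  rw [← hEF]
  simp_rw [hZ, aux_div_add h1 hX'd, aux_div_const_smul (-1) hXd]
  rw [integral_add (aux_div_int h1 h2).integrableOn
    ((aux_div_int hXd hXc).integrableOn.const_mul _), integral_const_mul]
  linarith

lemma aux_max {n : ℕ} {φ : Rn n → ℝ} (hφ : IsNormN φ) (ω : Rn n) :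
    ∃ ξ, φ ξ ≤ 1 ∧ ∀ ζ, φ ζ ≤ 1 → dotn ζ ω ≤ dotn ξ ω := by
  obtain ⟨hconv, hhom, c, hc, hcφ⟩ := hφ
  have hcont : Continuous φ := by
    rw [← continuousOn_univ]
    exact hconv.continuousOn isOpen_univ
  have hcomp : IsCompact {ξ | φ ξ ≤ 1} := by
    refine Metric.isCompact_of_isClosed_isBounded (isClosed_le hcont continuous_const) ?_
    refine (Metric.isBounded_closedBall (x := (0 : Rn n)) (r := 1 / c)).subset fun ξ hξ => ?_
    rw [mem_closedBall_zero_iff, le_div_iff₀ hc]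
    have := (hcφ ξ).trans hξ
    linarith
  have h0 : φ 0 = 0 := by simpa using hhom 0 0
  have hdc : Continuous (fun ξ : Rn n => dotn ξ ω) := by
    unfold dotn; fun_prop
  obtain ⟨ξ, hξ, hm⟩ := hcomp.exists_isMaxOn ⟨0, by simp [h0]⟩ hdc.continuousOn
  exact ⟨ξ, hξ, fun ζ hζ => hm hζ⟩

lemma aux_parallel {n : ℕ} {ν₁ ν₂ : Rn1 n} (hν₁ : enorm1 ν₁ = 1) (hν₂ : enorm1 ν₂ = 1)
    (hb : Real.arccos (dotp ν₁ ν₂) + Real.arccos ν₂.2 = Real.arccos ν₁.2) :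
    ∃ (ω : Rn n) (a b : ℝ), 0 ≤ a ∧ 0 ≤ b ∧ ν₁.1 = a • ω ∧ ν₂.1 = b • ω := by
  have e : ∀ ν : Rn1 n, enorm1 ν = 1 → ‖ν.1‖ ^ 2 = 1 - ν.2 ^ 2 := by
    intro ν h
    have := aux_dotp_self h
    rw [dotp, aux_dotn_inner, real_inner_self_eq_norm_sq] at this
    linarith
  have e1 := e ν₁ hν₁
  have e2 := e ν₂ hν₂
  have r1 := abs_le.1 ((sq_le_one_iff_abs_le_one ν₁.2).1 (by nlinarith [sq_nonneg ‖ν₁.1‖]))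
  have r2 := abs_le.1 ((sq_le_one_iff_abs_le_one ν₂.2).1 (by nlinarith [sq_nonneg ‖ν₂.1‖]))
  have l1 : -1 ≤ dotp ν₁ ν₂ := aux_cs hν₁.le hν₂
  have l2 : dotp ν₁ ν₂ ≤ 1 := by
    have : -1 ≤ dotp ((-1:ℝ) • ν₁) ν₂ := by
      refine aux_cs ?_ hν₂
      rw [enorm1, aux_dotp_smul_left, aux_dotp_comm, aux_dotp_smul_left, aux_dotp_self hν₁]
      simp
    rw [aux_dotp_smul_left] at this
    linarith
  have h := congrArg Real.cos (eq_sub_of_add_eq hb)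
  rw [Real.cos_sub, Real.cos_arccos l1 l2, Real.cos_arccos r1.1 r1.2, Real.cos_arccos r2.1 r2.2,
    Real.sin_arccos, Real.sin_arccos, ← e1, ← e2, Real.sqrt_sq (norm_nonneg _),
    Real.sqrt_sq (norm_nonneg _), dotp, aux_dotn_inner] at h
  have hin : inner ℝ ν₁.1 ν₂.1 = ‖ν₁.1‖ * ‖ν₂.1‖ := by linarith
  rw [inner_eq_norm_mul_iff_real] at hin
  by_cases hp : ν₁.1 = 0
  · exact ⟨ν₂.1, 0, 1, le_rfl, zero_le_one, by simp [hp], by simp⟩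
  · refine ⟨ν₁.1, 1, ‖ν₁.1‖⁻¹ * ‖ν₂.1‖, zero_le_one, by positivity, by simp, ?_⟩
    rw [mul_smul, hin, smul_smul, inv_mul_cancel₀ (norm_ne_zero_iff.2 hp), one_smul]

lemma aux_calib {n : ℕ} {Φ : Rn1 n → ℝ} {φ : Rn n → ℝ} (hφ : IsNormN φ) (hcyl : Cylindrical Φ φ)
    {ω ξ : Rn n} (hm : ∀ ζ, φ ζ ≤ 1 → dotn ζ ω ≤ dotn ξ ω) {ν : Rn1 n} {a : ℝ} (ha : 0 ≤ a)
    (hν : ν.1 = a • ω) (h0 : 0 ≤ ν.2) (η : Rn1 n) (hη : Φ η ≤ 1) :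
    0 ≤ dotp ((ξ, (1:ℝ)) + η) ν := by
  rw [hcyl] at hη
  have h1 := (le_max_left _ _).trans hη
  have h2 := (abs_le.1 ((le_max_right _ _).trans hη)).1
  have h3 := hm ((-1:ℝ) • η.1) (by rw [hφ.2.1]; simpa using h1)
  rw [aux_dotp_add_left, dotp, dotp, hν]
  simp only [aux_dotn_inner, inner_smul_left, inner_smul_right] at *
  simp at h3
  have h4 := mul_nonneg ha (by linarith : 0 ≤ inner ℝ ξ ω + inner ℝ η.1 ω)
  have h5 := mul_nonneg (by linarith : 0 ≤ 1 + η.2) h0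
  simp
  linarith

end Aux

theorem cones_minimize_perimeter {n : ℕ} (Φ : Rn1 n → ℝ) (φ : Rn n → ℝ)
    (hΦ : IsNorm1 Φ) (hφ : IsNormN φ) (hcyl : Cylindrical Φ φ)
    (ν₁ ν₂ : Rn1 n) (hν₁ : enorm1 ν₁ = 1) (hν₂ : enorm1 ν₂ = 1)
    (c₁ c₂ : ℝ)
    (H₁ H₂ : Set (Rn1 n))
    (hH₁ : H₁ = {z : Rn1 n | dotp z ν₁ ≤ c₁})
    (hH₂ : H₂ = {z : Rn1 n | dotp z ν₂ ≤ c₂})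
    (h0 : (0 : Rn1 n) ∈ {z : Rn1 n | dotp z ν₁ = c₁} ∩ {z : Rn1 n | dotp z ν₂ = c₂})
    (hsub : {z : Rn1 n | dotp z ν₁ = c₁} ∩ {z : Rn1 n | dotp z ν₂ = c₂} ⊆
      {z : Rn1 n | z.2 = 0})
    (ha₁ : 0 ≤ dotp ν₁ ν₂) (ha₂ : ν₁.2 ≤ ν₂.2) (ha₃ : 0 ≤ ν₁.2)
    (hb : Real.arccos (dotp ν₁ ν₂) + Real.arccos ν₂.2 = Real.arccos ν₁.2) :
    MinPer1 Φ (univ : Set (Rn1 n)) (H₁ ∩ H₂) ∧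
    MinPer1 Φ (univ : Set (Rn1 n)) (H₁ ∪ H₂) := by
  obtain ⟨hc1, hc2⟩ := h0
  have z : ∀ ν : Rn1 n, dotp 0 ν = 0 := fun ν => (auxL ν).map_zero
  have hc1' : c₁ = 0 := by rw [← z ν₁]; exact hc1.symm
  have hc2' : c₂ = 0 := by rw [← z ν₂]; exact hc2.symm
  subst hc1' hc2' hH₁ hH₂
  obtain ⟨ω, a, b, ha, hb', hp, hq⟩ := aux_parallel hν₁ hν₂ hb
  obtain ⟨ξ, hξ, hm⟩ := aux_max hφ ω
  have hN : Φ (ξ, (1:ℝ)) ≤ 1 := by rw [hcyl]; simpa using hξ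
  have hN1 := aux_calib hφ hcyl hm ha hp ha₃
  have hN2 := aux_calib hφ hcyl hm hb' hq (ha₃.trans ha₂)
  exact ⟨aux_min hΦ hν₁ hν₂ ha₁ (aux_inter ν₁ ν₂) hN hN1 hN2,
    aux_min hΦ hν₁ hν₂ ha₁ (aux_union ν₁ ν₂) hN hN1 hN2⟩
end
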